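/- Let {f_i}_{i∈I_c} and {g_j}_{j∈I_d} be families of flow and jump maps, let h⁰, h ∈ H, and let SW be a family of impulsive and switching sequences. Let Assumption 4 hold. If for each i ∈ I_c the function −φ̄_i is positive definite and there exists a constant θ_i > 0 such that SW ⊂ ∩_{i∈I_c} S_RDT^i[θ_i], ∫_1^∞ ds/(−φ̄_i(s)) = ∞, and N_i* := inf_{a>0} ∫_{ᾱ(a)}^a ds/(−φ̄_i(s)) > sup_{t≥0} ∫_t^{t+θ_i} p_i(s) ds =: M_i*, then {Σ_σ}_{σ∈SW} is strongly (h⁰,h)-ISS. -/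

import Mathlib

open MeasureTheory Filter Set
open scoped Classical

noncomputable section

/-- State/input spaces: `ℝ^k` with the Euclidean norm. -/
abbrev Stt (k : ℕ) : Type := EuclideanSpace ℝ (Fin k)

/-- An impulse-time sequence, identified with its (locally finite) set of impulse
times, a subset of `(0,∞)` with finitely many points below any bound. -/
def IsImpulseSeq (γ : Set ℝ) : Prop :=
  γ ⊆ Set.Ioi (0 : ℝ) ∧ ∀ T : ℝ, (γ ∩ Set.Iic T).Finite

/-- `n^γ_{(s,t]}`: the number of impulse times in the interval `(s,t]`. -/
def nJumps (γ : Set ℝ) (s t : ℝ) : ℕ := (γ ∩ Set.Ioc s t).ncard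

/-- Uniform incremental boundedness of a set of impulse-time sequences. -/
def UIB (S : Set (Set ℝ)) : Prop :=
  ∃ φ : ℝ → ℝ, ContinuousOn φ (Set.Ici 0) ∧ MonotoneOn φ (Set.Ici 0) ∧
    (∀ s : ℝ, 0 ≤ s → 0 ≤ φ s) ∧
    ∀ γ ∈ S, ∀ t0 t : ℝ, 0 ≤ t0 → t0 < t → (nJumps γ t0 t : ℝ) ≤ φ (t - t0)

/-- Class `K∞` functions `[0,∞) → [0,∞)`. -/
def ClassKInf (α : ℝ → ℝ) : Prop :=
  ContinuousOn α (Set.Ici 0) ∧ StrictMonoOn α (Set.Ici 0) ∧ α 0 = 0 ∧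
    ∀ M : ℝ, ∃ r : ℝ, 0 ≤ r ∧ M ≤ α r

/-- Class `KL` functions. -/
def ClassKL (β : ℝ → ℝ → ℝ) : Prop :=
  (∀ t : ℝ, 0 ≤ t → ClassKInf fun r => β r t) ∧
  ∀ r : ℝ, 0 ≤ r → AntitoneOn (fun t => β r t) (Set.Ici 0) ∧
    Filter.Tendsto (fun t => β r t) Filter.atTop (nhds 0)

/-- Positive definite functions `[0,∞) → [0,∞)`. -/
def PosDef (ρ : ℝ → ℝ) : Prop :=
  ContinuousOn ρ (Set.Ici 0) ∧ ρ 0 = 0 ∧ ∀ r : ℝ, 0 < r → 0 < ρ r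

/-- Locally integrable (on compacts) function `[0,∞) → ℝ` (extended to `ℝ`). -/
def LocIntegrable (p : ℝ → ℝ) : Prop :=
  ∀ a b : ℝ, MeasureTheory.IntegrableOn p (Set.Icc a b)

/-- Inputs: measurable, locally essentially bounded functions. -/
def IsInput {m : ℕ} (u : ℝ → Stt m) : Prop :=
  Measurable u ∧ ∀ T : ℝ, ∃ C : ℝ, ∀ᵐ t ∂MeasureTheory.volume, t ∈ Set.Icc 0 T → ‖u t‖ ≤ C

/-- `‖u_I‖_γ`: max of the essential supremum of `‖u‖` over `I` and the supremum of
`‖u‖` over `γ ∩ I`. -/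
def inputNorm {m : ℕ} (γ : Set ℝ) (u : ℝ → Stt m) (I : Set ℝ) : ℝ :=
  max (essSup (fun t => ‖u t‖) (MeasureTheory.volume.restrict I))
      (sSup ((fun t => ‖u t‖) '' (γ ∩ I)))

/-- Solution of the impulsive system `(γ,f,g)` on `[t0,T)` with initial state `x0`
and input `u` (Carathéodory solutions, in integral form, between impulses). -/
structure IsSolution {n m : ℕ} (γ : Set ℝ) (f g : ℝ → Stt n → Stt m → Stt n)
    (t0 : ℝ) (x0 : Stt n) (u : ℝ → Stt m) (T : EReal) (x : ℝ → Stt n) : Prop where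
  lt : (t0 : EReal) < T
  init : x t0 = x0
  flow : ∀ t1 t2 : ℝ, t0 ≤ t1 → t1 ≤ t2 → (t2 : EReal) < T → Set.Ioc t1 t2 ∩ γ = ∅ →
    MeasureTheory.IntegrableOn (fun s => f s (x s) (u s)) (Set.Icc t1 t2) ∧
    x t2 = x t1 + ∫ s in t1..t2, f s (x s) (u s)
  jump : ∀ t ∈ γ, t0 < t → (t : EReal) < T →
    ∃ L : Stt n, Filter.Tendsto x (nhdsWithin t (Set.Iio t)) (nhds L) ∧
      x t = L + g t L (u t)

/-- Maximally defined solution. -/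
def IsMaxSolution {n m : ℕ} (γ : Set ℝ) (f g : ℝ → Stt n → Stt m → Stt n)
    (t0 : ℝ) (x0 : Stt n) (u : ℝ → Stt m) (T : EReal) (x : ℝ → Stt n) : Prop :=
  IsSolution γ f g t0 x0 u T x ∧
    ∀ (T' : EReal) (x' : ℝ → Stt n), IsSolution γ f g t0 x0 u T' x' →
      (∀ t : ℝ, t0 ≤ t → (t : EReal) < T → x' t = x t) → T' ≤ T

/-- Weak `(h⁰,h)`-ISS of a parametrized family of impulsive systems. -/
def WeaklyISS {n m : ℕ} {Λ : Type*} (γ : Λ → Set ℝ)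
    (f g : Λ → ℝ → Stt n → Stt m → Stt n) (h0 h : ℝ → Stt n → ℝ) : Prop :=
  ∃ β : ℝ → ℝ → ℝ, ∃ ρ : ℝ → ℝ, ClassKL β ∧ ClassKInf ρ ∧
    ∀ (l : Λ) (t0 : ℝ) (x0 : Stt n) (u : ℝ → Stt m) (T : EReal) (x : ℝ → Stt n),
      0 ≤ t0 → IsInput u → IsMaxSolution (γ l) (f l) (g l) t0 x0 u T x →
      ∀ t : ℝ, t0 ≤ t → (t : EReal) < T →
        h t (x t) ≤ β (h0 t0 x0) (t - t0) + ρ (inputNorm (γ l) u (Set.Ioc t0 t))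

/-- Strong `(h⁰,h)`-ISS of a parametrized family of impulsive systems. -/
def StronglyISS {n m : ℕ} {Λ : Type*} (γ : Λ → Set ℝ)
    (f g : Λ → ℝ → Stt n → Stt m → Stt n) (h0 h : ℝ → Stt n → ℝ) : Prop :=
  ∃ β : ℝ → ℝ → ℝ, ∃ ρ : ℝ → ℝ, ClassKL β ∧ ClassKInf ρ ∧
    ∀ (l : Λ) (t0 : ℝ) (x0 : Stt n) (u : ℝ → Stt m) (T : EReal) (x : ℝ → Stt n),
      0 ≤ t0 → IsInput u → IsMaxSolution (γ l) (f l) (g l) t0 x0 u T x →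
      ∀ t : ℝ, t0 ≤ t → (t : EReal) < T →
        h t (x t) ≤ β (h0 t0 x0) (t - t0 + (nJumps (γ l) t0 t : ℝ)) +
          ρ (inputNorm (γ l) u (Set.Ioc t0 t))

/-- Locally Lipschitz on a set. -/
def LocLipschitzOn {α β : Type*} [PseudoEMetricSpace α] [PseudoEMetricSpace β]
    (s : Set α) (f : α → β) : Prop :=
  ∀ x ∈ s, ∃ K : NNReal, ∃ t ∈ nhdsWithin x s, LipschitzOnWith K f t

/-- `V ∈ V(γ)` with `Vm` its left-limit function at impulse times: `V` is locally
Lipschitz on each inter-impulse strip and has the joint left limit `Vm τ ξ`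
at each `τ ∈ γ`. -/
def InClassV {n : ℕ} (γ : Set ℝ) (V Vm : ℝ → Stt n → ℝ) : Prop :=
  (∀ a b : ℝ, 0 ≤ a → Set.Ioo a b ∩ γ = ∅ →
    LocLipschitzOn (Set.Ico a b ×ˢ (Set.univ : Set (Stt n)))
      (fun q : ℝ × Stt n => V q.1 q.2)) ∧
  ∀ τ ∈ γ, ∀ ξ : Stt n,
    Filter.Tendsto (fun q : ℝ × Stt n => V q.1 q.2)
      (nhdsWithin (τ, ξ) (Set.Iio τ ×ˢ (Set.univ : Set (Stt n)))) (nhds (Vm τ ξ))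

/-- Upper-right Dini derivative of `V` along the flow map `f`. -/
def DiniAlong {n m : ℕ} (f : ℝ → Stt n → Stt m → Stt n) (V : ℝ → Stt n → ℝ)
    (t : ℝ) (ξ : Stt n) (μ : Stt m) : ℝ :=
  Filter.limsup (fun d : ℝ => (V (t + d) (ξ + d • f t ξ μ) - V t ξ) / d)
    (nhdsWithin 0 (Set.Ioi 0))

/-- Carathéodory function `[0,∞) × [0,∞) → ℝ`. -/
def Caratheodory2 (φ : ℝ → ℝ → ℝ) : Prop :=
  (∀ r : ℝ, Measurable fun t => φ t r) ∧
  (∀ t : ℝ, ContinuousOn (φ t) (Set.Ici 0)) ∧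
  ∀ a b c : ℝ, ∃ mK : ℝ → ℝ, MeasureTheory.IntegrableOn mK (Set.Icc a b) ∧
    ∀ t ∈ Set.Icc a b, ∀ r ∈ Set.Icc (0 : ℝ) c, |φ t r| ≤ mK t

/-- Assumption 1 of the paper, with all the data explicit. -/
def Assumption1 {n m : ℕ} {Λ : Type*} (γ : Λ → Set ℝ)
    (f g : Λ → ℝ → Stt n → Stt m → Stt n) (h0 h : ℝ → Stt n → ℝ)
    (V Vm : Λ → ℝ → Stt n → ℝ) (φ1 φ2 χ π : ℝ → ℝ)
    (vφ al : Λ → ℝ → ℝ → ℝ) : Prop :=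
  ClassKInf φ1 ∧ ClassKInf φ2 ∧ ClassKInf χ ∧ ClassKInf π ∧
  (∀ l : Λ, InClassV (γ l) (V l) (Vm l)) ∧
  (∀ l : Λ, Caratheodory2 (vφ l)) ∧
  (∀ (l : Λ) (t r : ℝ), 0 ≤ t → 0 ≤ r → 0 ≤ al l t r) ∧
  (∀ (l : Λ) (t : ℝ) (ξ : Stt n), 0 ≤ t →
    φ1 (h t ξ) ≤ V l t ξ ∧ V l t ξ ≤ φ2 (h0 t ξ)) ∧
  (∀ (l : Λ) (t : ℝ) (ξ : Stt n) (μ : Stt m), 0 ≤ t → t ∉ γ l → χ ‖μ‖ ≤ V l t ξ →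
    DiniAlong (f l) (V l) t ξ μ ≤ - vφ l t (V l t ξ)) ∧
  (∀ (l : Λ) (t : ℝ) (ξ : Stt n) (μ : Stt m), t ∈ γ l → χ ‖μ‖ ≤ Vm l t ξ →
    V l t (ξ + g l t ξ μ) ≤ al l t (Vm l t ξ)) ∧
  (∀ (l : Λ) (t : ℝ) (ξ : Stt n) (μ : Stt m), t ∈ γ l → Vm l t ξ ≤ χ ‖μ‖ →
    V l t (ξ + g l t ξ μ) ≤ π ‖μ‖)

/-- Solution of the scalar comparison differential/difference inclusion. -/
structure IsCompSol (γ : Set ℝ) (vφ al : ℝ → ℝ → ℝ) (t0 z0 : ℝ) (T : EReal)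
    (z : ℝ → ℝ) : Prop where
  lt : (t0 : EReal) < T
  init : z t0 = z0
  nonneg : ∀ t : ℝ, t0 ≤ t → (t : EReal) < T → 0 ≤ z t
  flow : ∀ t1 t2 : ℝ, t0 ≤ t1 → t1 ≤ t2 → (t2 : EReal) < T → Set.Ioc t1 t2 ∩ γ = ∅ →
    ∃ d : ℝ → ℝ, MeasureTheory.IntegrableOn d (Set.Icc t1 t2) ∧
      (∀ᵐ s ∂MeasureTheory.volume, s ∈ Set.Icc t1 t2 → d s ≤ - vφ s (z s)) ∧
      ∀ t ∈ Set.Icc t1 t2, z t = z t1 + ∫ s in t1..t, d s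
  jump : ∀ t ∈ γ, t0 < t → (t : EReal) < T →
    ∃ L : ℝ, Filter.Tendsto z (nhdsWithin t (Set.Iio t)) (nhds L) ∧ z t ≤ al t L

/-- The family of comparison systems is weakly GUAS. -/
def CompWeakGUAS {Λ : Type*} (γ : Λ → Set ℝ) (vφ al : Λ → ℝ → ℝ → ℝ) : Prop :=
  ∃ β : ℝ → ℝ → ℝ, ClassKL β ∧
    ∀ (l : Λ) (t0 z0 : ℝ) (T : EReal) (z : ℝ → ℝ), 0 ≤ t0 → 0 ≤ z0 →
      IsCompSol (γ l) (vφ l) (al l) t0 z0 T z →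
      ∀ t : ℝ, t0 ≤ t → (t : EReal) < T → z t ≤ β z0 (t - t0)

/-- The family of comparison systems is strongly GUAS. -/
def CompStrongGUAS {Λ : Type*} (γ : Λ → Set ℝ) (vφ al : Λ → ℝ → ℝ → ℝ) : Prop :=
  ∃ β : ℝ → ℝ → ℝ, ClassKL β ∧
    ∀ (l : Λ) (t0 z0 : ℝ) (T : EReal) (z : ℝ → ℝ), 0 ≤ t0 → 0 ≤ z0 →
      IsCompSol (γ l) (vφ l) (al l) t0 z0 T z →
      ∀ t : ℝ, t0 ≤ t → (t : EReal) < T → z t ≤ β z0 (t - t0 + (nJumps (γ l) t0 t : ℝ))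

/-- Nonnegative Carathéodory solution of the scalar ODE `ẇ = rhs(t,w)` on `[t0,T)`. -/
structure IsODESol (rhs : ℝ → ℝ → ℝ) (t0 : ℝ) (T : EReal) (w : ℝ → ℝ) : Prop where
  lt : (t0 : EReal) < T
  nonneg : ∀ t : ℝ, t0 ≤ t → (t : EReal) < T → 0 ≤ w t
  flow : ∀ t1 t2 : ℝ, t0 ≤ t1 → t1 ≤ t2 → (t2 : EReal) < T →
    IntervalIntegrable (fun s => rhs s (w s)) MeasureTheory.volume t1 t2 ∧
    w t2 = w t1 + ∫ s in t1..t2, rhs s (w s)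

/-- Maximally defined forward-in-time solution of `ẇ = rhs(t,w)`. -/
def IsMaxODESol (rhs : ℝ → ℝ → ℝ) (t0 : ℝ) (T : EReal) (w : ℝ → ℝ) : Prop :=
  IsODESol rhs t0 T w ∧
    ∀ (T' : EReal) (w' : ℝ → ℝ), IsODESol rhs t0 T' w' →
      (∀ t : ℝ, t0 ≤ t → (t : EReal) < T → w' t = w t) → T' ≤ T

/-- GUAS of the family of scalar ODEs `ẇ = −φ_λ(t,w)`. -/
def ODEFamilyGUAS {Λ : Type*} (vφ : Λ → ℝ → ℝ → ℝ) : Prop :=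
  ∃ β : ℝ → ℝ → ℝ, ClassKL β ∧
    ∀ (l : Λ) (t0 : ℝ) (T : EReal) (w : ℝ → ℝ), 0 ≤ t0 →
      IsMaxODESol (fun s r => -(vφ l s r)) t0 T w →
      T = (⊤ : EReal) ∧ ∀ t : ℝ, t0 ≤ t → w t ≤ β (w t0) (t - t0)

/-- Solution (on all of `[0,∞)`) of the scalar linear ODE `ẇ = −p(t)·w`. -/
def IsLinSol (p : ℝ → ℝ) (w : ℝ → ℝ) : Prop :=
  ∀ t1 t2 : ℝ, 0 ≤ t1 → t1 ≤ t2 →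
    IntervalIntegrable (fun s => p s * w s) MeasureTheory.volume t1 t2 ∧
    w t2 = w t1 + ∫ s in t1..t2, -(p s * w s)

/-- An impulsive and switching sequence, described through its impulse-time set,
its two switching signals (constant between impulses), and the left limit of the
first switching signal at impulse times. -/
structure SwSignal (Ic Id : Type*) where
  γ : Set ℝ
  σ1 : ℝ → Ic
  σ1m : ℝ → Ic
  σ2 : ℝ → Id
  impulse : IsImpulseSeq γ
  const1 : ∀ a b : ℝ, 0 ≤ a → Set.Ioo a b ∩ γ = ∅ → ∀ t ∈ Set.Ico a b, σ1 t = σ1 a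
  const2 : ∀ a b : ℝ, 0 ≤ a → Set.Ioo a b ∩ γ = ∅ → ∀ t ∈ Set.Ico a b, σ2 t = σ2 a
  leftlim : ∀ t ∈ γ, ∀ᶠ s in nhdsWithin t (Set.Iio t), σ1 s = σ1m t

/-- `σ ∈ SW(J)`. -/
def InSW {Ic Id : Type*} (σ : SwSignal Ic Id) (J : Set (Ic × Ic × Id)) : Prop :=
  ∀ t ∈ σ.γ, (σ.σ1m t, σ.σ1 t, σ.σ2 t) ∈ J

/-- Flow map of the switched impulsive system `Σ_σ`. -/
def swF {n m : ℕ} {Ic Id : Type*} (F : Ic → ℝ → Stt n → Stt m → Stt n)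
    (σ : SwSignal Ic Id) : ℝ → Stt n → Stt m → Stt n :=
  fun t ξ μ => F (σ.σ1 t) t ξ μ

/-- Jump map of the switched impulsive system `Σ_σ`. -/
def swG {n m : ℕ} {Ic Id : Type*} (G : Id → ℝ → Stt n → Stt m → Stt n)
    (σ : SwSignal Ic Id) : ℝ → Stt n → Stt m → Stt n :=
  fun t ξ μ => G (σ.σ2 t) t ξ μ

/-- Weak `(h⁰,h)`-ISS of the family `{Σ_σ}_{σ ∈ SW}`. -/
def SwWeaklyISS {n m : ℕ} {Ic Id : Type*} (F : Ic → ℝ → Stt n → Stt m → Stt n)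
    (G : Id → ℝ → Stt n → Stt m → Stt n) (SW : Set (SwSignal Ic Id))
    (h0 h : ℝ → Stt n → ℝ) : Prop :=
  ∃ β : ℝ → ℝ → ℝ, ∃ ρ : ℝ → ℝ, ClassKL β ∧ ClassKInf ρ ∧
    ∀ σ ∈ SW, ∀ (t0 : ℝ) (x0 : Stt n) (u : ℝ → Stt m) (T : EReal) (x : ℝ → Stt n),
      0 ≤ t0 → IsInput u → IsMaxSolution σ.γ (swF F σ) (swG G σ) t0 x0 u T x →
      ∀ t : ℝ, t0 ≤ t → (t : EReal) < T →
        h t (x t) ≤ β (h0 t0 x0) (t - t0) + ρ (inputNorm σ.γ u (Set.Ioc t0 t))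

/-- Strong `(h⁰,h)`-ISS of the family `{Σ_σ}_{σ ∈ SW}`. -/
def SwStronglyISS {n m : ℕ} {Ic Id : Type*} (F : Ic → ℝ → Stt n → Stt m → Stt n)
    (G : Id → ℝ → Stt n → Stt m → Stt n) (SW : Set (SwSignal Ic Id))
    (h0 h : ℝ → Stt n → ℝ) : Prop :=
  ∃ β : ℝ → ℝ → ℝ, ∃ ρ : ℝ → ℝ, ClassKL β ∧ ClassKInf ρ ∧
    ∀ σ ∈ SW, ∀ (t0 : ℝ) (x0 : Stt n) (u : ℝ → Stt m) (T : EReal) (x : ℝ → Stt n),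
      0 ≤ t0 → IsInput u → IsMaxSolution σ.γ (swF F σ) (swG G σ) t0 x0 u T x →
      ∀ t : ℝ, t0 ≤ t → (t : EReal) < T →
        h t (x t) ≤ β (h0 t0 x0) (t - t0 + (nJumps σ.γ t0 t : ℝ)) +
          ρ (inputNorm σ.γ u (Set.Ioc t0 t))

/-- Total activation time in `(t0,t]` of the flow modes in `A`. -/
def actT {Ic Id : Type*} (σ : SwSignal Ic Id) (A : Set Ic) (t0 t : ℝ) : ℝ :=
  (MeasureTheory.volume {r : ℝ | r ∈ Set.Ioc t0 t ∧ σ.σ1 r ∈ A}).toReal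

/-- Number of impulse times in `(t0,t]` whose mode combination lies in `Jp`. -/
def nJumpsIn {Ic Id : Type*} (σ : SwSignal Ic Id) (Jp : Set (Ic × Ic × Id))
    (t0 t : ℝ) : ℕ :=
  (σ.γ ∩ Set.Ioc t0 t ∩ {r : ℝ | (σ.σ1m r, σ.σ1 r, σ.σ2 r) ∈ Jp}).ncard

/-- Assumption 2 of the paper (for switched impulsive systems), data explicit. -/
def Assumption2 {n m : ℕ} {Ic Id : Type*}
    (F : Ic → ℝ → Stt n → Stt m → Stt n) (G : Id → ℝ → Stt n → Stt m → Stt n)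
    (h0 h : ℝ → Stt n → ℝ) (J : Set (Ic × Ic × Id))
    (v : Ic → ℝ → Stt n → ℝ) (φ1 φ2 χ π : ℝ → ℝ)
    (vφ : Ic → ℝ → ℝ → ℝ) (al : Ic × Ic × Id → ℝ → ℝ → ℝ) : Prop :=
  ClassKInf φ1 ∧ ClassKInf φ2 ∧ ClassKInf χ ∧ ClassKInf π ∧
  (∀ i : Ic, LocLipschitzOn ((Set.Ici (0 : ℝ)) ×ˢ (Set.univ : Set (Stt n)))
      (fun q : ℝ × Stt n => v i q.1 q.2)) ∧
  (∀ i : Ic, Caratheodory2 (vφ i)) ∧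
  (∀ e ∈ J, ∀ t r : ℝ, 0 ≤ t → 0 ≤ r → 0 ≤ al e t r) ∧
  (∀ (i : Ic) (t : ℝ) (ξ : Stt n), 0 ≤ t →
    φ1 (h t ξ) ≤ v i t ξ ∧ v i t ξ ≤ φ2 (h0 t ξ)) ∧
  (∀ (i : Ic) (t : ℝ) (ξ : Stt n) (μ : Stt m), 0 ≤ t → χ ‖μ‖ ≤ v i t ξ →
    DiniAlong (F i) (v i) t ξ μ ≤ - vφ i t (v i t ξ)) ∧
  (∀ (ι i : Ic) (j : Id), (ι, i, j) ∈ J → ∀ (t : ℝ) (ξ : Stt n) (μ : Stt m),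
    0 ≤ t → χ ‖μ‖ ≤ v ι t ξ → v i t (ξ + G j t ξ μ) ≤ al (ι, i, j) t (v ι t ξ)) ∧
  (∀ (ι i : Ic) (j : Id), (ι, i, j) ∈ J → ∀ (t : ℝ) (ξ : Stt n) (μ : Stt m),
    0 ≤ t → v ι t ξ ≤ χ ‖μ‖ → v i t (ξ + G j t ξ μ) ≤ π ‖μ‖)

lemma ClassKInf.lt {α : ℝ → ℝ} (hα : ClassKInf α) {r s : ℝ} (hr : 0 ≤ r) (hrs : r < s) :
    α r < α s := hα.2.1 hr (hr.trans hrs.le) hrs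

lemma ClassKInf.le {α : ℝ → ℝ} (hα : ClassKInf α) {r s : ℝ} (hr : 0 ≤ r) (hrs : r ≤ s) :
    α r ≤ α s := hα.2.1.monotoneOn hr (hr.trans hrs) hrs

lemma ClassKInf.nonneg {α : ℝ → ℝ} (hα : ClassKInf α) {r : ℝ} (hr : 0 ≤ r) : 0 ≤ α r :=
  hα.2.2.1 ▸ hα.le le_rfl hr

lemma ClassKInf.pos {α : ℝ → ℝ} (hα : ClassKInf α) {r : ℝ} (hr : 0 < r) : 0 < α r :=
  hα.2.2.1 ▸ hα.lt le_rfl hr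

lemma ClassKInf.map_max {α : ℝ → ℝ} (hα : ClassKInf α) {r s : ℝ} (hr : 0 ≤ r) (hs : 0 ≤ s) :
    α (max r s) = max (α r) (α s) :=
  hα.2.1.monotoneOn.map_max hr hs

lemma ClassKInf.id : ClassKInf fun r => r :=
  ⟨continuousOn_id, fun _ _ _ _ h => h, rfl, fun M => ⟨max M 0, le_max_right _ _, le_max_left _ _⟩⟩

lemma ClassKInf.comp {α β : ℝ → ℝ} (hα : ClassKInf α) (hβ : ClassKInf β) :
    ClassKInf fun r => α (β r) := by
  refine ⟨hα.1.comp hβ.1 fun r hr => hβ.nonneg hr,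
    fun r hr s _ hrs => hα.lt (hβ.nonneg hr) (hβ.lt hr hrs), by simp [hβ.2.2.1, hα.2.2.1],
    fun M => ?_⟩
  obtain ⟨s, hs, hMs⟩ := hα.2.2.2 M
  obtain ⟨r, hr, hsr⟩ := hβ.2.2.2 s
  exact ⟨r, hr, hMs.trans (hα.le hs hsr)⟩

lemma ClassKInf.iterate {α : ℝ → ℝ} (hα : ClassKInf α) (k : ℕ) : ClassKInf α^[k] := by
  induction k with
  | zero => exact ClassKInf.id
  | succ k ih => rw [Function.iterate_succ']; exact hα.comp ih

lemma ClassKInf.surjOn {α : ℝ → ℝ} (hα : ClassKInf α) : SurjOn α (Ici 0) (Ici 0) := by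
  intro y hy
  obtain ⟨r, hr, hyr⟩ := hα.2.2.2 y
  obtain ⟨s, hs, rfl⟩ := intermediate_value_Icc hr (hα.1.mono Icc_subset_Ici_self)
    ⟨by rw [hα.2.2.1]; exact hy, hyr⟩
  exact ⟨s, hs.1, rfl⟩

lemma ClassKInf.of_surjOn {α : ℝ → ℝ} (hmono : StrictMonoOn α (Ici 0)) (h0 : α 0 = 0)
    (hsurj : SurjOn α (Ici 0) (Ici 0)) : ClassKInf α := by
  refine ⟨?_, hmono, h0, fun M => ?_⟩
  · set A : ℝ → ℝ := fun r => if 0 ≤ r then α r else r with hA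
    have hnn : ∀ r, 0 ≤ r → 0 ≤ α r := fun r hr => h0 ▸ hmono.monotoneOn (self_mem_Ici) hr hr
    have hAm : Monotone A := by
      intro r s hrs
      simp only [hA]
      split_ifs with h1 h2 h2
      · exact hmono.monotoneOn h1 h2 hrs
      · exact absurd (h1.trans hrs) h2
      · exact (not_le.1 h1).le.trans (hnn s h2)
      · exact hrs
    have hAs : Function.Surjective A := by
      intro y
      by_cases hy : 0 ≤ y
      · obtain ⟨r, hr, rfl⟩ := hsurj hy
        exact ⟨r, if_pos hr⟩
      · exact ⟨y, if_neg hy⟩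
    exact (hAm.continuous_of_surjective hAs).continuousOn.congr fun r hr => (if_pos hr).symm
  · obtain ⟨r, hr, hrM⟩ := hsurj (le_max_right M 0)
    exact ⟨r, hr, hrM ▸ le_max_left _ _⟩

lemma ClassKInf.exists_inverse {α : ℝ → ℝ} (hα : ClassKInf α) :
    ∃ β : ℝ → ℝ, ClassKInf β ∧ (∀ r, 0 ≤ r → β (α r) = r) := by
  have hex : ∀ y : ℝ, 0 ≤ y → ∃ r : ℝ, 0 ≤ r ∧ α r = y := fun y hy => hα.surjOn hy
  choose! β hβ using hex
  have hinv : ∀ r, 0 ≤ r → β (α r) = r := fun r hr =>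
    hα.2.1.injOn (hβ _ (hα.nonneg hr)).1 hr (hβ _ (hα.nonneg hr)).2
  refine ⟨β, ClassKInf.of_surjOn ?_ ?_ ?_, hinv⟩
  · intro r hr s hs hrs
    rw [← hα.2.1.lt_iff_lt (hβ _ hr).1 (hβ _ hs).1, (hβ _ hr).2, (hβ _ hs).2]
    exact hrs
  · have := hinv 0 le_rfl
    rwa [hα.2.2.1] at this
  · exact fun r hr => ⟨α r, hα.nonneg hr, hinv r hr⟩

/-- A finite family of class `K∞` functions has a pointwise maximum of class `K∞`. -/
lemma ClassKInf.exists_max {ι : Type*} [Finite ι] [Nonempty ι] {E : ι → ℝ → ℝ}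
    (hE : ∀ i, ClassKInf (E i)) :
    ∃ A : ℝ → ℝ, ClassKInf A ∧ (∀ i r, E i r ≤ A r) ∧ ∀ r, ∃ i, A r = E i r := by
  have := Fintype.ofFinite ι
  have hex : ∀ r, ∃ i, Finset.univ.sup' Finset.univ_nonempty (fun i => E i r) = E i r := fun r => by
    obtain ⟨i, -, hi⟩ := Finset.exists_mem_eq_sup' Finset.univ_nonempty fun i => E i r
    exact ⟨i, hi⟩
  have hle : ∀ i r, E i r ≤ Finset.univ.sup' Finset.univ_nonempty (fun i => E i r) := fun i r =>
    Finset.le_sup' (fun i => E i r) (Finset.mem_univ i)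
  refine ⟨fun r => Finset.univ.sup' Finset.univ_nonempty fun i => E i r,
    ⟨?_, ?_, ?_, ?_⟩, hle, hex⟩
  · exact ContinuousOn.finset_sup'_apply Finset.univ_nonempty fun i _ => (hE i).1
  · intro r hr s _ hrs
    obtain ⟨i, hi⟩ := hex r
    exact (hi.le.trans_lt ((hE i).lt hr hrs)).trans_le (hle i s)
  · obtain ⟨i, hi⟩ := hex 0
    exact hi.trans (hE i).2.2.1
  · intro M
    obtain ⟨i⟩ := ‹Nonempty ι›
    obtain ⟨r, hr, hM⟩ := (hE i).2.2.2 M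
    exact ⟨r, hr, hM.trans (hle i r)⟩

lemma antitone_iterate_of_lt_self {α : ℝ → ℝ} (hα : ClassKInf α) (hlt : ∀ r, 0 < r → α r < r)
    {r : ℝ} (hr : 0 ≤ r) : Antitone fun k => α^[k] r := by
  refine antitone_nat_of_succ_le fun k => ?_
  rw [Function.iterate_succ_apply']
  rcases ((hα.iterate k).nonneg hr).eq_or_lt with h | h
  · rw [← h, hα.2.2.1]
  · exact (hlt _ h).le

lemma tendsto_iterate_of_lt_self {α : ℝ → ℝ} (hα : ClassKInf α) (hlt : ∀ r, 0 < r → α r < r)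
    {r : ℝ} (hr : 0 ≤ r) : Tendsto (fun k => α^[k] r) atTop (nhds 0) := by
  have hnn : ∀ k, 0 ≤ α^[k] r := fun k => (hα.iterate k).nonneg hr
  have hbdd : BddBelow (range fun k => α^[k] r) := ⟨0, by rintro _ ⟨k, rfl⟩; exact hnn k⟩
  have hlim := tendsto_atTop_ciInf (antitone_iterate_of_lt_self hα hlt hr) hbdd
  set l := ⨅ k, α^[k] r with hl
  have hl0 : 0 ≤ l := le_ciInf hnn
  have hlim' : Tendsto (fun k => α (α^[k] r)) atTop (nhds (α l)) :=
    ((hα.1 l hl0).tendsto.comp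
      (tendsto_nhdsWithin_iff.2 ⟨hlim, Eventually.of_forall hnn⟩))
  have hfix : α l = l := by
    refine tendsto_nhds_unique hlim' ?_
    have := hlim.comp (tendsto_add_atTop_nat 1)
    simpa only [Function.comp_def, Function.iterate_succ_apply'] using this
  rcases hl0.eq_or_lt with h | h
  · rwa [← h] at hlim
  · exact absurd hfix (hlt l h).ne

/-- Iterating a class `K∞` contraction at a rate proportional to time gives a `KL` function. -/
lemma classKL_iterate {A B E : ℝ → ℝ} (hA : ClassKInf A) (hB : ClassKInf B) (hE : ClassKInf E)
    (hlt : ∀ r, 0 < r → E r < r) {Θ : ℝ} (hΘ : 0 < Θ) :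
    ClassKL fun r s => A (E^[⌊(s - Θ) / (Θ + 1)⌋₊] (B r)) := by
  refine ⟨fun s _ => hA.comp ((hE.iterate _).comp hB), fun r hr => ⟨?_, ?_⟩⟩
  · intro s _ s' _ hss
    refine hA.le ((hE.iterate _).nonneg (hB.nonneg hr)) ?_
    refine antitone_iterate_of_lt_self hE hlt (hB.nonneg hr) (Nat.floor_mono ?_)
    gcongr
  · have hfl : Tendsto (fun s : ℝ => ⌊(s - Θ) / (Θ + 1)⌋₊) atTop atTop := by
      refine tendsto_nat_floor_atTop.comp ?_
      refine Tendsto.atTop_div_const (by positivity) ?_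
      exact tendsto_atTop_add_const_right _ (-Θ) tendsto_id
    have h1 := (tendsto_iterate_of_lt_self hE hlt (hB.nonneg hr)).comp hfl
    have h2 : Tendsto A (nhdsWithin 0 (Ici 0)) (nhds 0) := by
      have := (hA.1 0 self_mem_Ici).tendsto
      rwa [hA.2.2.1] at this
    exact h2.comp (tendsto_nhdsWithin_iff.2
      ⟨h1, Eventually.of_forall fun s => (hE.iterate _).nonneg (hB.nonneg hr)⟩)

/-- The primitive `r ↦ ∫₁^r ds / ψ(s)` of the reciprocal of a rate `ψ`. -/
def osgood (ψ : ℝ → ℝ) (r : ℝ) : ℝ := ∫ s in (1 : ℝ)..r, (ψ s)⁻¹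

section Osgood

variable {ψ : ℝ → ℝ}

lemma PosDef.continuousOn_inv (hψ : PosDef ψ) : ContinuousOn (fun s => (ψ s)⁻¹) (Ioi 0) :=
  (hψ.1.mono Ioi_subset_Ici_self).inv₀ fun r hr => (hψ.2.2 r hr).ne'

lemma PosDef.intervalIntegrable_inv (hψ : PosDef ψ) {a b : ℝ} (ha : 0 < a) (hb : 0 < b) :
    IntervalIntegrable (fun s => (ψ s)⁻¹) volume a b := by
  refine (hψ.continuousOn_inv.mono fun s hs => ?_).intervalIntegrable
  exact (lt_min ha hb).trans_le hs.1

lemma PosDef.integral_inv_eq (hψ : PosDef ψ) {a b : ℝ} (ha : 0 < a) (hb : 0 < b) :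
    ∫ s in a..b, (ψ s)⁻¹ = osgood ψ b - osgood ψ a :=
  (intervalIntegral.integral_interval_sub_left (hψ.intervalIntegrable_inv one_pos hb)
    (hψ.intervalIntegrable_inv one_pos ha)).symm

lemma PosDef.hasDerivAt_osgood (hψ : PosDef ψ) {r : ℝ} (hr : 0 < r) :
    HasDerivAt (osgood ψ) (ψ r)⁻¹ r :=
  intervalIntegral.integral_hasDerivAt_right (hψ.intervalIntegrable_inv one_pos hr)
    (hψ.continuousOn_inv.stronglyMeasurableAtFilter isOpen_Ioi r hr)
    (hψ.continuousOn_inv.continuousAt (Ioi_mem_nhds hr))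

lemma PosDef.continuousOn_osgood (hψ : PosDef ψ) : ContinuousOn (osgood ψ) (Ioi 0) :=
  fun _ hr => (hψ.hasDerivAt_osgood hr).continuousAt.continuousWithinAt

lemma PosDef.strictMonoOn_osgood (hψ : PosDef ψ) : StrictMonoOn (osgood ψ) (Ioi 0) := by
  refine strictMonoOn_of_deriv_pos (convex_Ioi 0) hψ.continuousOn_osgood fun r hr => ?_
  rw [interior_Ioi] at hr
  rw [(hψ.hasDerivAt_osgood hr).deriv]
  exact inv_pos.2 (hψ.2.2 r hr)

lemma PosDef.osgood_unbounded_above (hψ : PosDef ψ)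
    (hdiv : ¬ IntegrableOn (fun s => (ψ s)⁻¹) (Ici 1)) (y : ℝ) :
    ∃ r, 0 < r ∧ y ≤ osgood ψ r := by
  by_contra! hcon
  refine hdiv ?_
  rw [integrableOn_Ici_iff_integrableOn_Ioi]
  refine integrableOn_Ioi_of_intervalIntegral_norm_bounded (ι := ℝ) (l := atTop) (b := fun r => r)
    y 1 (fun r => ?_) tendsto_id ?_
  · rcases le_total r 1 with h | h
    · simp [Ioc_eq_empty (not_lt.2 h)]
    · exact (intervalIntegrable_iff_integrableOn_Ioc_of_le h).1
        (hψ.intervalIntegrable_inv one_pos (one_pos.trans_le h))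
  · filter_upwards [eventually_ge_atTop 1] with r hr
    refine le_trans (le_of_eq ?_) (hcon r (one_pos.trans_le hr)).le
    refine intervalIntegral.integral_congr fun s hs => ?_
    rw [uIcc_of_le hr] at hs
    exact Real.norm_of_nonneg (inv_pos.2 (hψ.2.2 s (one_pos.trans_le hs.1))).le

lemma PosDef.osgood_unbounded_below {α : ℝ → ℝ} (hα : PosDef α) {N : ℝ}
    (hN : 0 < N) (hjump : ∀ a, 0 < a → osgood ψ (α a) + N ≤ osgood ψ a) (y : ℝ) :
    ∃ r, 0 < r ∧ osgood ψ r ≤ y := by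
  have key : ∀ k : ℕ, 0 < α^[k] 1 ∧ osgood ψ (α^[k] 1) + k * N ≤ osgood ψ 1 := by
    intro k
    induction k with
    | zero => simp
    | succ k ih =>
      rw [Function.iterate_succ_apply']
      refine ⟨hα.2.2 _ ih.1, ?_⟩
      have := hjump _ ih.1
      push_cast
      linarith [ih.2]
  obtain ⟨k, hk⟩ := exists_nat_ge ((osgood ψ 1 - y) / N)
  refine ⟨α^[k] 1, (key k).1, ?_⟩
  rw [div_le_iff₀ hN] at hk
  linarith [(key k).2]

lemma PosDef.osgood_surjective (hψ : PosDef ψ)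
    (habove : ∀ y, ∃ r, 0 < r ∧ y ≤ osgood ψ r) (hbelow : ∀ y, ∃ r, 0 < r ∧ osgood ψ r ≤ y)
    (y : ℝ) : ∃ r, 0 < r ∧ osgood ψ r = y := by
  obtain ⟨a, ha, hay⟩ := hbelow y
  obtain ⟨b, hb, hyb⟩ := habove y
  exact isPreconnected_Ioi.intermediate_value ha hb hψ.continuousOn_osgood ⟨hay, hyb⟩

/-- The time-`c` flow of `ṙ = ψ(r)`, as a class `K∞` function. -/
lemma PosDef.exists_osgood_shift (hψ : PosDef ψ) (hsurj : ∀ y, ∃ r, 0 < r ∧ osgood ψ r = y)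
    (c : ℝ) : ∃ E : ℝ → ℝ, ClassKInf E ∧ ∀ r, 0 < r → osgood ψ (E r) = osgood ψ r + c := by
  choose inv hpos hinv using hsurj
  set E : ℝ → ℝ := fun r => if 0 < r then inv (osgood ψ r + c) else 0 with hE
  have hEpos : ∀ r, 0 < r → E r = inv (osgood ψ r + c) := fun r hr => if_pos hr
  have hE0 : E 0 = 0 := if_neg (lt_irrefl _)
  have hEeq : ∀ r, 0 < r → osgood ψ (E r) = osgood ψ r + c := fun r hr => by
    rw [hEpos r hr, hinv]
  refine ⟨E, ClassKInf.of_surjOn ?_ hE0 ?_, hEeq⟩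
  · intro r hr s _ hrs
    have hs : 0 < s := lt_of_le_of_lt hr hrs
    rcases (mem_Ici.1 hr).eq_or_lt with rfl | hr
    · rw [hE0, hEpos s hs]
      exact hpos _
    · rw [← hψ.strictMonoOn_osgood.lt_iff_lt (by rw [hEpos r hr]; exact hpos _)
        (by rw [hEpos s hs]; exact hpos _), hEeq r hr, hEeq s hs]
      have := hψ.strictMonoOn_osgood (mem_Ioi.2 hr) hs hrs
      linarith
  · intro s hs
    rcases (mem_Ici.1 hs).eq_or_lt with rfl | hs
    · exact ⟨0, self_mem_Ici, hE0⟩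
    · refine ⟨inv (osgood ψ s - c), (hpos _).le, ?_⟩
      refine hψ.strictMonoOn_osgood.injOn (by rw [hEpos _ (hpos _)]; exact hpos _) hs ?_
      rw [hEeq _ (hpos _), hinv]
      ring

end Osgood

lemma AbsolutelyContinuousOnInterval.of_dist_le {X Y : Type*} [PseudoMetricSpace X]
    [PseudoMetricSpace Y] {f : ℝ → X} {g : ℝ → Y} {a b : ℝ}
    (hg : AbsolutelyContinuousOnInterval g a b)
    (h : ∀ s ∈ uIcc a b, ∀ t ∈ uIcc a b, dist (f s) (f t) ≤ dist (g s) (g t)) :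
    AbsolutelyContinuousOnInterval f a b := by
  rw [absolutelyContinuousOnInterval_iff] at hg ⊢
  intro ε hε
  obtain ⟨δ, hδ, hE⟩ := hg ε hε
  exact ⟨δ, hδ, fun E hEd hEδ => (Finset.sum_le_sum fun i hi =>
    h _ (hEd.1 i hi).1 _ (hEd.1 i hi).2).trans_lt (hE E hEd hEδ)⟩

/-- A Lipschitz function of an absolutely continuous real function is absolutely continuous. -/
lemma LipschitzOnWith.comp_absolutelyContinuousOnInterval {X : Type*} [PseudoMetricSpace X]
    {f : ℝ → X} {g : ℝ → ℝ} {a b : ℝ} {K : NNReal} {S : Set ℝ} (hf : LipschitzOnWith K f S)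
    (hg : AbsolutelyContinuousOnInterval g a b) (hS : MapsTo g (uIcc a b) S) :
    AbsolutelyContinuousOnInterval (fun s => f (g s)) a b := by
  refine (hg.const_mul (K : ℝ)).of_dist_le fun s hs t ht => ?_
  refine (hf.dist_le_mul _ (hS hs) _ (hS ht)).trans (le_of_eq ?_)
  rw [Real.dist_eq, Real.dist_eq, ← mul_sub, abs_mul, NNReal.abs_eq]

/-- A function which grows at most at rate `p ψ` while above the level `c` needs the `ψ`-time
`∫ p` to climb. -/
lemma osgood_max_le {ψ y p : ℝ → ℝ} (hψ : PosDef ψ) {a b c : ℝ} (hab : a ≤ b) (hc : 0 < c)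
    (hy : AbsolutelyContinuousOnInterval y a b) (hp : IntervalIntegrable p volume a b)
    (hp0 : ∀ s ∈ Icc a b, 0 ≤ p s)
    (h : ∀ᵐ s, s ∈ Ioo a b → c < y s → deriv y s ≤ p s * ψ (y s)) :
    osgood ψ (max (y b) c) ≤ osgood ψ (max (y a) c) + ∫ s in a..b, p s := by
  set w : ℝ → ℝ := fun s => max (y s) c with hw
  set z : ℝ → ℝ := fun s => osgood ψ (w s) with hz
  have hwac : AbsolutelyContinuousOnInterval w a b := by
    refine hy.of_dist_le fun s _ t _ => ?_
    simp only [hw, Real.dist_eq]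
    exact abs_max_sub_max_le_abs _ _ _
  obtain ⟨C, hC⟩ := hwac.exists_bound
  have hmaps : MapsTo w (uIcc a b) (Icc c C) := fun s hs =>
    ⟨le_max_right _ _, (le_abs_self _).trans (hC s hs)⟩
  obtain ⟨K, hK⟩ : ∃ K, LipschitzOnWith K (osgood ψ) (Icc c C) := by
    refine ContDiffOn.exists_lipschitzOnWith (n := 1) ?_ (by decide) (convex_Icc _ _)
      isCompact_Icc
    refine ContDiffOn.mono ?_ (fun s hs => hc.trans_le hs.1 : Icc c C ⊆ Ioi 0)
    refine (contDiffOn_succ_iff_deriv_of_isOpen (n := 0) isOpen_Ioi).2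
      ⟨fun r hr => (hψ.hasDerivAt_osgood hr).differentiableAt.differentiableWithinAt, by simp, ?_⟩
    rw [contDiffOn_zero]
    exact hψ.continuousOn_inv.congr fun r hr => (hψ.hasDerivAt_osgood hr).deriv
  have hzac : AbsolutelyContinuousOnInterval z a b :=
    hK.comp_absolutelyContinuousOnInterval hwac hmaps
  have hderiv : ∀ᵐ s, s ∈ Ioo a b → deriv z s ≤ p s := by
    filter_upwards [h, hy.ae_differentiableAt] with s hs hds hsab
    have hsI : s ∈ uIcc a b := by rw [uIcc_of_le hab]; exact Ioo_subset_Icc_self hsab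
    rcases le_or_gt (y s) c with hyc | hyc
    · have hmin : IsLocalMin z s := by
        refine Eventually.of_forall fun t => ?_
        have : w s = c := max_eq_right hyc
        simp only [hz]
        rw [this]
        exact hψ.strictMonoOn_osgood.monotoneOn hc (hc.trans_le (le_max_right _ _))
          (le_max_right _ _)
      rw [hmin.deriv_eq_zero]
      exact hp0 s (Ioo_subset_Icc_self hsab)
    · have hypos : 0 < y s := hc.trans hyc
      have hev : z =ᶠ[nhds s] fun t => osgood ψ (y t) := by
        filter_upwards [(hds hsI).continuousAt.eventually_const_lt hyc] with t ht
        simp only [hz, hw]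
        rw [max_eq_left ht.le]
      rw [hev.deriv_eq]
      have := (hψ.hasDerivAt_osgood hypos).comp s (hds hsI).hasDerivAt
      rw [show deriv (fun t => osgood ψ (y t)) s = _ from this.deriv]
      rw [inv_mul_le_iff₀ (hψ.2.2 _ hypos), mul_comm]
      exact hs hsab hyc
  have hint := hzac.integral_deriv_eq_sub
  have hle : ∫ s in a..b, deriv z s ≤ ∫ s in a..b, p s := by
    refine intervalIntegral.integral_mono_ae_restrict hab hzac.intervalIntegrable_deriv hp ?_
    rw [← Measure.restrict_congr_set Ioo_ae_eq_Icc]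
    exact (ae_restrict_iff' measurableSet_Ioo).2 hderiv
  simp only [hz, hw] at hint hle
  linarith

/-- Along a curve `x` with velocity `f(s, x(s), μ)` at time `s`, the Dini derivative of a locally
Lipschitz `V` is the derivative of `V(t, x(t))`. -/
lemma DiniAlong_eq_deriv {n m : ℕ} {f : ℝ → Stt n → Stt m → Stt n} {V : ℝ → Stt n → ℝ}
    {x : ℝ → Stt n} {s : ℝ} {μ : Stt m}
    (hV : LocLipschitzOn ((Ici (0 : ℝ)) ×ˢ (univ : Set (Stt n))) fun q : ℝ × Stt n => V q.1 q.2)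
    (hs : 0 ≤ s) (hx : HasDerivAt x (f s (x s) μ) s)
    (hy : DifferentiableAt ℝ (fun t => V t (x t)) s) :
    DiniAlong f V s (x s) μ = deriv (fun t => V t (x t)) s := by
  set y' := deriv (fun t => V t (x t)) s
  set ζ := f s (x s) μ with hζ
  obtain ⟨K, N, hN, hK⟩ := hV (s, x s) ⟨hs, mem_univ _⟩
  have hpos : ∀ᶠ d : ℝ in nhdsWithin 0 (Ioi 0), 0 < d := self_mem_nhdsWithin
  have htime : Tendsto (fun d : ℝ => s + d) (nhdsWithin 0 (Ioi 0)) (nhds s) := by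
    have : Tendsto (fun d : ℝ => s + d) (nhds 0) (nhds (s + 0)) := by
      exact (continuous_const.add continuous_id).tendsto 0
    rw [add_zero] at this
    exact this.mono_left nhdsWithin_le_nhds
  have hmem1 : ∀ᶠ d : ℝ in nhdsWithin 0 (Ioi 0), (s + d, x (s + d)) ∈ N := by
    have : Tendsto (fun d : ℝ => (s + d, x (s + d))) (nhdsWithin 0 (Ioi 0))
        (nhdsWithin (s, x s) (Ici (0 : ℝ) ×ˢ univ)) := by
      refine tendsto_nhdsWithin_iff.2 ⟨htime.prodMk_nhds (hx.continuousAt.tendsto.comp htime), ?_⟩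
      filter_upwards [hpos] with d hd using ⟨add_nonneg hs hd.le, mem_univ _⟩
    exact this.eventually hN
  have hmem2 : ∀ᶠ d : ℝ in nhdsWithin 0 (Ioi 0), (s + d, x s + d • ζ) ∈ N := by
    have : Tendsto (fun d : ℝ => (s + d, x s + d • ζ)) (nhdsWithin 0 (Ioi 0))
        (nhdsWithin (s, x s) (Ici (0 : ℝ) ×ˢ univ)) := by
      refine tendsto_nhdsWithin_iff.2 ⟨htime.prodMk_nhds ?_, ?_⟩
      · have : Tendsto (fun d : ℝ => x s + d • ζ) (nhds 0) (nhds (x s + (0 : ℝ) • ζ)) :=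
          (continuous_const.add (continuous_id.smul continuous_const)).tendsto 0
        rw [zero_smul, add_zero] at this
        exact this.mono_left nhdsWithin_le_nhds
      · filter_upwards [hpos] with d hd using ⟨add_nonneg hs hd.le, mem_univ _⟩
    exact this.eventually hN
  have hxs : Tendsto (fun d : ℝ => d⁻¹ • (x (s + d) - x s)) (nhdsWithin 0 (Ioi 0)) (nhds ζ) :=
    (hasDerivAt_iff_tendsto_slope_zero.1 hx).mono_left
      (nhdsWithin_mono _ fun d hd => (mem_Ioi.1 hd).ne')
  have hys : Tendsto (fun d : ℝ => d⁻¹ • (V (s + d) (x (s + d)) - V s (x s)))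
      (nhdsWithin 0 (Ioi 0)) (nhds y') :=
    (hasDerivAt_iff_tendsto_slope_zero.1 hy.hasDerivAt).mono_left
      (nhdsWithin_mono _ fun d hd => (mem_Ioi.1 hd).ne')
  have hdiff : Tendsto (fun d : ℝ => (V (s + d) (x s + d • ζ) - V s (x s)) / d -
      d⁻¹ • (V (s + d) (x (s + d)) - V s (x s))) (nhdsWithin 0 (Ioi 0)) (nhds 0) := by
    have hb : Tendsto (fun d : ℝ => K * ‖ζ - d⁻¹ • (x (s + d) - x s)‖)
        (nhdsWithin 0 (Ioi 0)) (nhds 0) := by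
      have := ((tendsto_const_nhds (x := ζ)).sub hxs).norm.const_mul (K : ℝ)
      simpa using this
    refine squeeze_zero_norm' ?_ hb
    filter_upwards [hpos, hmem1, hmem2] with d hd h1 h2
    have hlip := hK.dist_le_mul _ h2 _ h1
    rw [dist_prod_same_left, dist_eq_norm, dist_eq_norm] at hlip
    have e1 : (V (s + d) (x s + d • ζ) - V s (x s)) / d -
        d⁻¹ • (V (s + d) (x (s + d)) - V s (x s)) =
        d⁻¹ * (V (s + d) (x s + d • ζ) - V (s + d) (x (s + d))) := by
      rw [smul_eq_mul]; field_simp; ring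
    have e2 : ζ - d⁻¹ • (x (s + d) - x s) = d⁻¹ • (x s + d • ζ - x (s + d)) := by
      rw [show x s + d • ζ - x (s + d) = d • ζ - (x (s + d) - x s) by abel,
        smul_sub _ (d • ζ), inv_smul_smul₀ hd.ne']
    rw [e1, e2, norm_mul, norm_smul]
    calc ‖d⁻¹‖ * _ ≤ ‖d⁻¹‖ * (K * ‖x s + d • ζ - x (s + d)‖) := by gcongr
      _ = _ := by ring
  have hq : Tendsto (fun d : ℝ => (V (s + d) (x s + d • ζ) - V s (x s)) / d)
      (nhdsWithin 0 (Ioi 0)) (nhds y') := by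
    simpa using hdiff.add hys
  exact hq.limsup_eq

/-- A locally Lipschitz function of an integral curve is absolutely continuous. -/
lemma absolutelyContinuousOnInterval_comp_integral {n : ℕ} {V : ℝ → Stt n → ℝ}
    {x φ : ℝ → Stt n} {a b : ℝ}
    (hV : LocLipschitzOn ((Ici (0 : ℝ)) ×ˢ (univ : Set (Stt n))) fun q : ℝ × Stt n => V q.1 q.2)
    (ha : 0 ≤ a) (hab : a ≤ b) (hφ : IntervalIntegrable φ volume a b)
    (hx : ∀ s ∈ Icc a b, x s = x a + ∫ r in a..s, φ r) :
    AbsolutelyContinuousOnInterval (fun t => V t (x t)) a b := by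
  set P : ℝ → ℝ := fun t => t + ∫ r in a..t, ‖φ r‖ with hP
  have hPac : AbsolutelyContinuousOnInterval P a b :=
    AbsolutelyContinuousOnInterval.add
      (LipschitzWith.id.lipschitzOnWith.absolutelyContinuousOnInterval (f := fun t : ℝ => t))
      (hφ.norm.absolutelyContinuousOnInterval_intervalIntegral left_mem_uIcc)
  have hsub : ∀ s ∈ Icc a b, ∀ t ∈ Icc a b, IntervalIntegrable φ volume s t :=
    fun s hs t ht => hφ.mono_set (by
      rw [uIcc_of_le hab]; exact uIcc_subset_Icc hs ht)
  have hal : a ∈ Icc a b := left_mem_Icc.2 hab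
  have hdist : ∀ s ∈ Icc a b, ∀ t ∈ Icc a b, s ≤ t →
      dist (s, x s) (t, x t) ≤ dist (P s) (P t) := by
    intro s hs t ht hst
    have e1 : x t - x s = ∫ r in s..t, φ r := by
      rw [hx t ht, hx s hs, add_sub_add_left_eq_sub]
      exact intervalIntegral.integral_interval_sub_left (hsub a hal t ht) (hsub a hal s hs)
    have e2 : P t - P s = (t - s) + ∫ r in s..t, ‖φ r‖ := by
      rw [← intervalIntegral.integral_interval_sub_left (hsub a hal t ht).norm
        (hsub a hal s hs).norm]
      simp only [hP]; ring
    have h3 : 0 ≤ ∫ r in s..t, ‖φ r‖ :=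
      intervalIntegral.integral_nonneg hst fun r _ => norm_nonneg _
    rw [dist_comm, dist_comm (P s), Real.dist_eq, e2, abs_of_nonneg (by linarith), Prod.dist_eq]
    refine max_le ?_ ?_
    · rw [Real.dist_eq, abs_of_nonneg (by linarith)]
      linarith
    · rw [dist_eq_norm, e1]
      linarith [intervalIntegral.norm_integral_le_integral_norm hst (f := φ) (μ := volume)]
  have hcurve : AbsolutelyContinuousOnInterval (fun t => (t, x t)) a b := by
    refine hPac.of_dist_le fun s hs t ht => ?_
    rw [uIcc_of_le hab] at hs ht
    rcases le_total s t with hst | hst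
    · exact hdist s hs t ht hst
    · rw [dist_comm, dist_comm (P s)]
      exact hdist t ht s hs hst
  have hcomp : IsCompact ((fun t => (t, x t)) '' Icc a b) := by
    have := hcurve.continuousOn
    rw [uIcc_of_le hab] at this
    exact isCompact_Icc.image_of_continuousOn this
  have hsubset : (fun t => (t, x t)) '' Icc a b ⊆ Ici (0 : ℝ) ×ˢ univ := by
    rintro _ ⟨t, ht, rfl⟩
    exact ⟨ha.trans ht.1, mem_univ _⟩
  obtain ⟨K, hK⟩ : ∃ K, LipschitzOnWith K (fun q : ℝ × Stt n => V q.1 q.2)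
      ((fun t => (t, x t)) '' Icc a b) := by
    refine LocallyLipschitzOn.exists_lipschitzOnWith_of_compact hcomp fun q hq => ?_
    obtain ⟨K, N, hN, hK⟩ := hV q (hsubset hq)
    exact ⟨K, N, nhdsWithin_mono _ hsubset hN, hK⟩
  refine (hcurve.const_smul (K : ℝ)).of_dist_le fun s hs t ht => ?_
  rw [uIcc_of_le hab] at hs ht
  refine (hK.dist_le_mul _ ⟨s, hs, rfl⟩ _ ⟨t, ht, rfl⟩).trans (le_of_eq ?_)
  simp only [dist_eq_norm, ← smul_sub, norm_smul]
  simp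

lemma IsImpulseSeq.exists_last {γ : Set ℝ} (hγ : IsImpulseSeq γ) {t0 t : ℝ} (h : t0 < t) :
    ∃ s, t0 ≤ s ∧ s < t ∧ (s = t0 ∨ s ∈ γ) ∧ Ioo s t ∩ γ = ∅ := by
  have hfin : (insert t0 (γ ∩ Ioo t0 t)).Finite :=
    ((hγ.2 t).subset fun s hs => ⟨hs.1, hs.2.2.le⟩).insert t0
  obtain ⟨s, hs, hmax⟩ := exists_max_image _ _root_.id hfin ⟨t0, mem_insert _ _⟩
  have hts : t0 ≤ s := hmax t0 (mem_insert _ _)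
  refine ⟨s, hts, ?_, hs.imp_right And.left, ?_⟩
  · rcases hs with rfl | hs
    · exact h
    · exact hs.2.2
  · refine eq_empty_of_forall_notMem fun r hr => ?_
    exact (hmax r (mem_insert_of_mem _ ⟨hr.2, hts.trans_lt hr.1.1, hr.1.2⟩)).not_gt hr.1.1

lemma IsImpulseSeq.nJumps_eq {γ : Set ℝ} (hγ : IsImpulseSeq γ) {t0 s t : ℝ} (hts : t0 ≤ s)
    (hst : s < t) (hempty : Ioo s t ∩ γ = ∅) :
    nJumps γ t0 t = nJumps γ t0 s + if t ∈ γ then 1 else 0 := by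
  have hnot : ∀ r, r ∈ γ → s < r → r < t → False := fun r hr h1 h2 =>
    (eq_empty_iff_forall_notMem.1 hempty r) ⟨⟨h1, h2⟩, hr⟩
  split_ifs with ht
  · have : γ ∩ Ioc t0 t = insert t (γ ∩ Ioc t0 s) := by
      ext r
      constructor
      · rintro ⟨hr, h1, h2⟩
        rcases h2.eq_or_lt with rfl | h2
        · exact mem_insert _ _
        · exact mem_insert_of_mem _ ⟨hr, h1, not_lt.1 fun h => hnot r hr h h2⟩
      · rintro (rfl | ⟨hr, h1, h2⟩)
        · exact ⟨ht, hts.trans_lt hst, le_rfl⟩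
        · exact ⟨hr, h1, h2.trans hst.le⟩
    rw [nJumps, this, ncard_insert_of_notMem (fun h => h.2.2.not_gt hst)
      ((hγ.2 s).subset fun r hr => ⟨hr.1, hr.2.2⟩), nJumps]
  · have : γ ∩ Ioc t0 t = γ ∩ Ioc t0 s := by
      ext r
      refine ⟨fun ⟨hr, h1, h2⟩ => ⟨hr, h1, not_lt.1 fun h => hnot r hr h (h2.lt_of_ne ?_)⟩,
        fun ⟨hr, h1, h2⟩ => ⟨hr, h1, h2.trans hst.le⟩⟩
      rintro rfl
      exact ht hr
    rw [nJumps, this, nJumps, add_zero]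

/-- A trajectory which grows at most by `H` between impulses and is contracted by `E` over each
impulse, modulo the level `R`, is bounded by the iterates of `E`. -/
lemma impulsive_iterate_bound {γ : Set ℝ} (hγ : IsImpulseSeq γ) {Y E H : ℝ → ℝ} {t0 tf R Θ : ℝ}
    (hE : ClassKInf E) (hElt : ∀ r, 0 < r → E r < r) (hH : ClassKInf H)
    (hHle : ∀ r, 0 ≤ r → r ≤ H r) (hR : 0 ≤ R) (hΘ : 0 ≤ Θ) (hY : ∀ t, t0 ≤ t → 0 ≤ Y t)
    (hdwell : ∀ a t, t0 ≤ a → a < t → Ioo a t ∩ γ = ∅ → t ≤ a + Θ)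
    (hjump : ∀ a t, t0 ≤ a → a < t → t ≤ tf → Ioo a t ∩ γ = ∅ → t ∈ γ →
      Y t ≤ max (E (max (Y a) R)) R)
    (hflow : ∀ a t, t0 ≤ a → a < t → t ≤ tf → Ioo a t ∩ γ = ∅ → t ∉ γ → Y t ≤ H (max (Y a) R))
    {t : ℝ} (ht0 : t0 ≤ t) (htf : t ≤ tf) :
    t - t0 ≤ (nJumps γ t0 t + 1) * Θ ∧ Y t ≤ H (max (E^[nJumps γ t0 t] (Y t0)) R) := by
  have hEle : ∀ r, 0 ≤ r → E r ≤ r := fun r hr => by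
    rcases hr.eq_or_lt with rfl | hr
    · exact hE.2.2.1.le
    · exact (hElt r hr).le
  have hnn : ∀ k, 0 ≤ E^[k] (Y t0) := fun k => (hE.iterate k).nonneg (hY t0 le_rfl)
  have key : ∀ k : ℕ, ∀ s, t0 ≤ s → s ≤ tf → (s = t0 ∨ s ∈ γ) → nJumps γ t0 s = k →
      s - t0 ≤ k * Θ ∧ Y s ≤ max (E^[k] (Y t0)) R := by
    intro k
    induction k with
    | zero =>
      intro s hs _ hsγ hk
      have : s = t0 := by
        refine hsγ.elim _root_.id fun h => (hs.eq_or_lt).elim Eq.symm fun hlt => ?_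
        have hfin : (γ ∩ Ioc t0 s).Finite := (hγ.2 s).subset fun r hr => ⟨hr.1, hr.2.2⟩
        have := (ncard_eq_zero hfin).1 hk
        exact (eq_empty_iff_forall_notMem.1 this s ⟨h, hlt, le_rfl⟩).elim
      subst this
      simp
    | succ k ih =>
      intro s hs hsf hsγ hk
      have hlt : t0 < s := hs.lt_of_ne (by rintro rfl; simp [nJumps] at hk)
      have hsγ' : s ∈ γ := hsγ.resolve_left hlt.ne'
      obtain ⟨a, ha0, has, haγ, hempty⟩ := hγ.exists_last hlt
      have hcount := hγ.nJumps_eq ha0 has hempty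
      rw [if_pos hsγ', hk] at hcount
      obtain ⟨hd, hb⟩ := ih a ha0 (has.le.trans hsf) haγ (by omega)
      have h1 := hdwell a s ha0 has hempty
      have h2 := hjump a s ha0 has hsf hempty hsγ'
      refine ⟨by push_cast; linarith, h2.trans (max_le ?_ (le_max_right _ _))⟩
      have h3 : max (Y a) R ≤ max (E^[k] (Y t0)) R := max_le hb (le_max_right _ _)
      refine (hE.le (hR.trans (le_max_right _ _)) h3).trans ?_
      rw [hE.map_max (hnn k) hR, Function.iterate_succ_apply']
      exact max_le_max le_rfl (hEle R hR)
  by_cases hcase : t = t0 ∨ t ∈ γ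
  · obtain ⟨hd, hb⟩ := key _ t ht0 htf hcase rfl
    exact ⟨by linarith, hb.trans (hHle _ (hR.trans (le_max_right _ _)))⟩
  · push Not at hcase
    obtain ⟨a, ha0, hat, haγ, hempty⟩ := hγ.exists_last (ht0.lt_of_ne hcase.1.symm)
    have hcount := hγ.nJumps_eq ha0 hat hempty
    rw [if_neg hcase.2, add_zero] at hcount
    obtain ⟨hd, hb⟩ := key _ a ha0 (hat.le.trans htf) haγ rfl
    rw [hcount]
    have h1 := hdwell a t ha0 hat hempty
    refine ⟨by linarith, (hflow a t ha0 hat htf hempty hcase.2).trans ?_⟩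
    exact hH.le (hR.trans (le_max_right _ _)) (max_le hb (le_max_right _ _))

section InputNorm

variable {m : ℕ} {γ : Set ℝ} {u : ℝ → Stt m}

lemma IsImpulseSeq.norm_le_inputNorm (hγ : IsImpulseSeq γ) {a b s : ℝ} (hs : s ∈ γ)
    (hsab : s ∈ Ioc a b) : ‖u s‖ ≤ inputNorm γ u (Ioc a b) := by
  refine le_trans ?_ (le_max_right _ _)
  have hfin : (γ ∩ Ioc a b).Finite := (hγ.2 b).subset fun r hr => ⟨hr.1, hr.2.2⟩
  exact le_csSup (hfin.image _).bddAbove ⟨s, ⟨hs, hsab⟩, rfl⟩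

lemma inputNorm_nonneg (I : Set ℝ) : 0 ≤ inputNorm γ u I := by
  refine le_trans (Real.sSup_nonneg ?_) (le_max_right _ _)
  rintro _ ⟨s, -, rfl⟩
  exact norm_nonneg _

lemma IsInput.ae_norm_le_inputNorm (hu : IsInput u) {a b : ℝ} (ha : 0 ≤ a) :
    ∀ᵐ s, s ∈ Ioc a b → ‖u s‖ ≤ inputNorm γ u (Ioc a b) := by
  rw [← ae_restrict_iff' measurableSet_Ioc]
  obtain ⟨C, hC⟩ := hu.2 b
  have hbdd : IsBoundedUnder (· ≤ ·) (ae (volume.restrict (Ioc a b))) fun s => ‖u s‖ := by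
    refine ⟨C, ?_⟩
    rw [eventually_map, ae_restrict_iff' measurableSet_Ioc]
    filter_upwards [hC] with s hs hsab using hs ⟨ha.trans hsab.1.le, hsab.2⟩
  filter_upwards [ae_le_essSup hbdd] with s hs using hs.trans (le_max_left _ _)

end InputNorm

/-- Under reverse dwell times, every time is followed within the dwell time of the active mode by
an impulse. -/
lemma SwSignal.exists_next {Ic Id : Type*} (σ : SwSignal Ic Id) {θ : Ic → ℝ}
    (hRDT : ∀ (i : Ic) (s : ℝ), (s = 0 ∨ s ∈ σ.γ) → σ.σ1 s = i → ∃ t ∈ σ.γ, s < t ∧ t ≤ s + θ i)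
    {s : ℝ} (hs : 0 ≤ s) :
    ∃ τ ∈ σ.γ, s < τ ∧ τ ≤ s + θ (σ.σ1 s) ∧ Ioo s τ ∩ σ.γ = ∅ := by
  obtain ⟨a, ha0, has, haγ, hempty⟩ :
      ∃ a, 0 ≤ a ∧ a ≤ s ∧ (a = 0 ∨ a ∈ σ.γ) ∧ Ioc a s ∩ σ.γ = ∅ := by
    by_cases hcase : s = 0 ∨ s ∈ σ.γ
    · exact ⟨s, hs, le_rfl, hcase, by simp⟩
    · push Not at hcase
      obtain ⟨a, ha0, has, haγ, hempty⟩ := σ.impulse.exists_last (hs.lt_of_ne hcase.1.symm)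
      refine ⟨a, ha0, has.le, haγ, eq_empty_of_forall_notMem fun r hr => ?_⟩
      rcases hr.1.2.eq_or_lt with rfl | hlt
      · exact hcase.2 hr.2
      · exact eq_empty_iff_forall_notMem.1 hempty r ⟨⟨hr.1.1, hlt⟩, hr.2⟩
  obtain ⟨τ', hτ', haτ, hτθ⟩ := hRDT _ a haγ rfl
  have hsτ' : s < τ' := not_le.1 fun h =>
    eq_empty_iff_forall_notMem.1 hempty τ' ⟨⟨haτ, h⟩, hτ'⟩
  have hfin : (σ.γ ∩ Ioc s τ').Finite := (σ.impulse.2 τ').subset fun r hr => ⟨hr.1, hr.2.2⟩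
  obtain ⟨τ, hτ, hmin⟩ := exists_min_image _ _root_.id hfin ⟨τ', hτ', hsτ', le_rfl⟩
  have hsτ : Ioo s τ ∩ σ.γ = ∅ := eq_empty_of_forall_notMem fun r hr =>
    (hmin r ⟨hr.2, hr.1.1, hr.1.2.le.trans hτ.2.2⟩).not_gt hr.1.2
  have hmode : σ.σ1 s = σ.σ1 a := by
    refine σ.const1 a τ ha0 (eq_empty_of_forall_notMem fun r hr => ?_) s ⟨has, hτ.2.1⟩
    rcases le_or_gt r s with h | h
    · exact eq_empty_iff_forall_notMem.1 hempty r ⟨⟨hr.1.1, h⟩, hr.2⟩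
    · exact eq_empty_iff_forall_notMem.1 hsτ r ⟨⟨h, hr.1.2⟩, hr.2⟩
  exact ⟨τ, hτ.1, hτ.2.1, hmode ▸ hτ.2.2.trans (hτθ.trans (by gcongr)), hsτ⟩

/-- Growth estimate for a Lyapunov function along an impulse-free piece of a solution. -/
lemma IsSolution.osgood_max_le {n m : ℕ} {γ : Set ℝ} {f g : ℝ → Stt n → Stt m → Stt n}
    {t0 : ℝ} {x0 : Stt n} {u : ℝ → Stt m} {T : EReal} {x : ℝ → Stt n}
    (hsol : IsSolution γ f g t0 x0 u T x) {V : ℝ → Stt n → ℝ} {ψ p χ : ℝ → ℝ} {a b c : ℝ}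
    (hV : LocLipschitzOn ((Ici (0 : ℝ)) ×ˢ (univ : Set (Stt n))) fun q : ℝ × Stt n => V q.1 q.2)
    (hψ : PosDef ψ) (hp : LocIntegrable p) (hp0 : ∀ t, 0 ≤ t → 0 ≤ p t)
    (ht0 : 0 ≤ t0) (ha : t0 ≤ a) (hab : a ≤ b) (hbT : (b : EReal) < T)
    (hempty : Ioc a b ∩ γ = ∅) (hc : 0 < c) (hu : ∀ᵐ s, s ∈ Ioo a b → χ ‖u s‖ ≤ c)
    (hDini : ∀ s ∈ Ioo a b, χ ‖u s‖ ≤ V s (x s) →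
      DiniAlong f V s (x s) (u s) ≤ p s * ψ (V s (x s))) :
    osgood ψ (max (V b (x b)) c) ≤ osgood ψ (max (V a (x a)) c) + ∫ s in a..b, p s := by
  have ha0 : 0 ≤ a := ht0.trans ha
  have hint : IntervalIntegrable (fun s => f s (x s) (u s)) volume a b :=
    (intervalIntegrable_iff_integrableOn_Icc_of_le hab).2 (hsol.flow a b ha hab hbT hempty).1
  have hx : ∀ s ∈ Icc a b, x s = x a + ∫ r in a..s, f r (x r) (u r) := fun s hs =>
    (hsol.flow a s ha hs.1 ((EReal.coe_le_coe_iff.2 hs.2).trans_lt hbT)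
      (subset_empty_iff.1 (hempty ▸ inter_subset_inter_left _ (Ioc_subset_Ioc_right hs.2)))).2
  have hac := absolutelyContinuousOnInterval_comp_integral hV ha0 hab hint hx
  refine _root_.osgood_max_le (y := fun t => V t (x t)) hψ hab hc hac
    ((intervalIntegrable_iff_integrableOn_Icc_of_le hab).2 (hp a b))
    (fun s hs => hp0 s (ha0.trans hs.1)) ?_
  filter_upwards [hu, hac.ae_differentiableAt, hint.ae_hasDerivAt_integral] with s hus hys hxs hs hcs
  have hsI : s ∈ uIcc a b := by rw [uIcc_of_le hab]; exact Ioo_subset_Icc_self hs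
  have hxd : HasDerivAt x (f s (x s) (u s)) s := by
    refine ((hxs hsI a left_mem_uIcc).const_add (x a)).congr_of_eventuallyEq ?_
    filter_upwards [Icc_mem_nhds hs.1 hs.2] with r hr using hx r hr
  rw [← DiniAlong_eq_deriv hV (ha0.trans hs.1.le) hxd (hys hsI)]
  exact hDini s hs ((hus hs).trans hcs.le)

lemma ClassKInf.le_of_forall_pos_add {H : ℝ → ℝ} (hH : ClassKInf H) {y r s : ℝ} (hr : 0 ≤ r)
    (h : ∀ ε, 0 < ε → y ≤ H (max r (s + ε))) : y ≤ H (max r s) := by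
  have hlim : Tendsto (fun ε : ℝ => max r (s + ε)) (nhdsWithin 0 (Ioi 0)) (nhds (max r s)) := by
    have : Continuous fun ε : ℝ => max r (s + ε) := by fun_prop
    simpa using (this.tendsto 0).mono_left nhdsWithin_le_nhds
  have hin : Tendsto (fun ε : ℝ => max r (s + ε)) (nhdsWithin 0 (Ioi 0))
      (nhdsWithin (max r s) (Ici 0)) :=
    tendsto_nhdsWithin_iff.2 ⟨hlim, Eventually.of_forall fun _ => hr.trans (le_max_left _ _)⟩
  refine ge_of_tendsto ((hH.1 _ (hr.trans (le_max_left _ _))).tendsto.comp hin) ?_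
  filter_upwards [self_mem_nhdsWithin] with ε hε using h ε hε

/-- A positive infimum of the `ψ`-times gained by jumps through `α` is a lower bound for them; an
infimum of an unbounded set would be zero by convention. -/
lemma PosDef.osgood_jump_of_sInf {ψ α : ℝ → ℝ} (hψ : PosDef ψ) (hα : PosDef α)
    (hN : 0 < sInf ((fun a => ∫ s in (α a)..a, (ψ s)⁻¹) '' Ioi 0)) {a : ℝ} (ha : 0 < a) :
    osgood ψ (α a) + sInf ((fun a => ∫ s in (α a)..a, (ψ s)⁻¹) '' Ioi 0) ≤ osgood ψ a := by
  have hbdd : BddBelow ((fun a => ∫ s in (α a)..a, (ψ s)⁻¹) '' Ioi 0) := by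
    by_contra hcon
    rw [Real.sInf_of_not_bddBelow hcon] at hN
    exact hN.false
  have := csInf_le hbdd ⟨a, ha, rfl⟩
  simp only at this
  rw [hψ.integral_inv_eq (hα.2.2 _ ha) ha] at this
  linarith

/-- Growth estimate during one activation of a mode. -/
lemma IsSolution.mode_osgood_max_le {n m : ℕ} {Ic Id : Type*} {σ : SwSignal Ic Id}
    {F : Ic → ℝ → Stt n → Stt m → Stt n} {g : ℝ → Stt n → Stt m → Stt n}
    {t0 : ℝ} {x0 : Stt n} {u : ℝ → Stt m} {T : EReal} {x : ℝ → Stt n}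
    (hsol : IsSolution σ.γ (swF F σ) g t0 x0 u T x) {V : ℝ → Stt n → ℝ} {ψ p χ : ℝ → ℝ}
    {a b c d M : ℝ}
    (hV : LocLipschitzOn ((Ici (0 : ℝ)) ×ˢ (univ : Set (Stt n))) fun q : ℝ × Stt n => V q.1 q.2)
    (hψ : PosDef ψ) (hp : LocIntegrable p) (hp0 : ∀ t, 0 ≤ t → 0 ≤ p t)
    (hDini : ∀ (t : ℝ) (ξ : Stt n) (μ : Stt m), 0 ≤ t → χ ‖μ‖ ≤ V t ξ →
      DiniAlong (F (σ.σ1 a)) V t ξ μ ≤ p t * ψ (V t ξ))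
    (ht0 : 0 ≤ t0) (ha : t0 ≤ a) (hab : a ≤ b) (hbT : (b : EReal) < T)
    (hempty : Ioc a b ∩ σ.γ = ∅) (hc : 0 < c) (hu : ∀ᵐ s, s ∈ Ioo a b → χ ‖u s‖ ≤ c)
    (hbd : b ≤ d) (hM : ∫ s in a..d, p s ≤ M) :
    osgood ψ (max (V b (x b)) c) ≤ osgood ψ (max (V a (x a)) c) + M := by
  have ha0 : 0 ≤ a := ht0.trans ha
  have hint : ∀ r s : ℝ, r ≤ s → IntervalIntegrable p volume r s := fun r s hrs =>
    (intervalIntegrable_iff_integrableOn_Icc_of_le hrs).2 (hp r s)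
  refine (hsol.osgood_max_le hV hψ hp hp0 ht0 ha hab hbT hempty hc hu ?_).trans ?_
  · intro s hs hχ
    have hmode : σ.σ1 s = σ.σ1 a := σ.const1 a b ha0
      (subset_empty_iff.1 (hempty ▸ inter_subset_inter_left _ Ioo_subset_Ioc_self)) s
      ⟨hs.1.le, hs.2⟩
    have := hDini s (x s) (u s) (ha0.trans hs.1.le) hχ
    rw [← hmode] at this
    exact this
  · have h1 := intervalIntegral.integral_add_adjacent_intervals (hint a b hab) (hint b d hbd)
    have h2 : 0 ≤ ∫ s in b..d, p s :=
      intervalIntegral.integral_nonneg hbd fun s hs => hp0 s ((ha0.trans hab).trans hs.1)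
    linarith

lemma LocLipschitzOn.tendsto_left {n : ℕ} {V : ℝ → Stt n → ℝ} {x : ℝ → Stt n} {t : ℝ}
    {L : Stt n}
    (hV : LocLipschitzOn ((Ici (0 : ℝ)) ×ˢ (univ : Set (Stt n))) fun q : ℝ × Stt n => V q.1 q.2)
    (ht : 0 < t) (hL : Tendsto x (nhdsWithin t (Iio t)) (nhds L)) :
    Tendsto (fun s => V s (x s)) (nhdsWithin t (Iio t)) (nhds (V t L)) := by
  have hcont : ContinuousOn (fun q : ℝ × Stt n => V q.1 q.2) (Ici (0 : ℝ) ×ˢ univ) :=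
    LocallyLipschitzOn.continuousOn fun _ hq => hV _ hq
  have hin : Tendsto (fun s => (s, x s)) (nhdsWithin t (Iio t))
      (nhdsWithin (t, L) (Ici (0 : ℝ) ×ˢ univ)) := by
    refine tendsto_nhdsWithin_iff.2 ⟨(tendsto_id.mono_left nhdsWithin_le_nhds).prodMk_nhds hL, ?_⟩
    filter_upwards [nhdsWithin_le_nhds (Ioi_mem_nhds ht)] with s hs using ⟨mem_Ici.2 (mem_Ioi.1 hs).le, mem_univ _⟩
  exact (hcont (t, L) ⟨ht.le, mem_univ _⟩).tendsto.comp hin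

/-- One jump of the Lyapunov function after an activation whose growth is at most `M`. -/
lemma osgood_jump_le {ψ α E : ℝ → ℝ} {M N c z l y π : ℝ} (hψ : PosDef ψ) (hα : PosDef α)
    (hN : ∀ a, 0 < a → osgood ψ (α a) + N ≤ osgood ψ a) (hE : ClassKInf E)
    (hEψ : ∀ r, 0 < r → osgood ψ (E r) = osgood ψ r + (M - N)) (hc : 0 < c) (hl : 0 ≤ l)
    (hflow : osgood ψ (max l c) ≤ osgood ψ (max z c) + M) (hy : y ≤ α l ∨ y ≤ π) (hπ : π ≤ c) :
    y ≤ max (E (max z c)) c := by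
  have hz : 0 < max z c := hc.trans_le (le_max_right _ _)
  rcases hy with hy | hy
  · refine hy.trans (le_trans ?_ (le_max_left _ _))
    rcases hl.eq_or_lt with rfl | hl
    · rw [hα.2.1]
      exact hE.nonneg hz.le
    · rw [← hψ.strictMonoOn_osgood.le_iff_le (hα.2.2 _ hl) (hE.pos hz), hEψ _ hz]
      have h1 := hN l hl
      have h2 : osgood ψ l ≤ osgood ψ (max l c) :=
        hψ.strictMonoOn_osgood.monotoneOn hl (hl.trans_le (le_max_left _ _)) (le_max_left _ _)
      linarith
  · exact (hy.trans hπ).trans (le_max_right _ _)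

/-- Bound on a Lyapunov function along a solution of a switched impulsive system with maximum
dwell times, with an input-dependent level `R`. -/
lemma IsSolution.switched_bound {n m : ℕ} {Ic Id : Type*} {σ : SwSignal Ic Id}
    {F : Ic → ℝ → Stt n → Stt m → Stt n} {G : Id → ℝ → Stt n → Stt m → Stt n}
    {t0 : ℝ} {x0 : Stt n} {u : ℝ → Stt m} {T : EReal} {x : ℝ → Stt n}
    (hsol : IsSolution σ.γ (swF F σ) (swG G σ) t0 x0 u T x) {v : Ic → ℝ → Stt n → ℝ}
    {ψ p : Ic → ℝ → ℝ} {χ π α E H : ℝ → ℝ} {EE HH : Ic → ℝ → ℝ} {θ M N : Ic → ℝ} {R tf Θ : ℝ}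
    (hV : ∀ i, LocLipschitzOn ((Ici (0 : ℝ)) ×ˢ (univ : Set (Stt n)))
      fun q : ℝ × Stt n => v i q.1 q.2)
    (hv : ∀ i t ξ, 0 ≤ t → 0 ≤ v i t ξ)
    (hψ : ∀ i, PosDef (ψ i)) (hp : ∀ i, LocIntegrable (p i)) (hp0 : ∀ i t, 0 ≤ t → 0 ≤ p i t)
    (hα : PosDef α)
    (hDini : ∀ (i : Ic) (t : ℝ) (ξ : Stt n) (μ : Stt m), 0 ≤ t → χ ‖μ‖ ≤ v i t ξ →
      DiniAlong (F i) (v i) t ξ μ ≤ p i t * ψ i (v i t ξ))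
    (hjump : ∀ (k i : Ic) (j : Id) (t : ℝ) (ξ : Stt n) (μ : Stt m), 0 ≤ t →
      v i t (ξ + G j t ξ μ) ≤ α (v k t ξ) ∨ v i t (ξ + G j t ξ μ) ≤ π ‖μ‖)
    (hRDT : ∀ (i : Ic) (s : ℝ), (s = 0 ∨ s ∈ σ.γ) → σ.σ1 s = i → ∃ t ∈ σ.γ, s < t ∧ t ≤ s + θ i)
    (hΘ : ∀ i, θ i ≤ Θ) (hΘ0 : 0 ≤ Θ)
    (hM : ∀ i t, 0 ≤ t → ∫ s in t..(t + θ i), p i s ≤ M i)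
    (hN : ∀ i a, 0 < a → osgood (ψ i) (α a) + N i ≤ osgood (ψ i) a)
    (hE : ClassKInf E) (hElt : ∀ r, 0 < r → E r < r) (hEE : ∀ i, ClassKInf (EE i))
    (hEEψ : ∀ i r, 0 < r → osgood (ψ i) (EE i r) = osgood (ψ i) r + (M i - N i))
    (hEEle : ∀ i r, EE i r ≤ E r)
    (hH : ClassKInf H) (hHle : ∀ r, 0 ≤ r → r ≤ H r) (hHH : ∀ i, ClassKInf (HH i))
    (hHHψ : ∀ i r, 0 < r → osgood (ψ i) (HH i r) = osgood (ψ i) r + M i)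
    (hHHle : ∀ i r, HH i r ≤ H r)
    (ht0 : 0 ≤ t0) (htf : t0 ≤ tf) (htfT : (tf : EReal) < T) (hR : 0 < R)
    (huflow : ∀ᵐ s, s ∈ Ioc t0 tf → χ ‖u s‖ ≤ R)
    (hujump : ∀ s ∈ σ.γ, s ∈ Ioc t0 tf → π ‖u s‖ ≤ R) :
    tf - t0 ≤ (nJumps σ.γ t0 tf + 1) * Θ ∧
      v (σ.σ1 tf) tf (x tf) ≤ H (max (E^[nJumps σ.γ t0 tf] (v (σ.σ1 t0) t0 x0)) R) := by
  have hnext : ∀ a t, t0 ≤ a → a < t → Ioo a t ∩ σ.γ = ∅ → t ≤ a + θ (σ.σ1 a) := by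
    intro a t ha hat hempty
    obtain ⟨τ, hτ, haτ, hτθ, -⟩ := σ.exists_next hRDT (ht0.trans ha)
    refine le_trans (not_lt.1 fun h => ?_) hτθ
    exact eq_empty_iff_forall_notMem.1 hempty τ ⟨⟨haτ, h⟩, hτ⟩
  have hgrow : ∀ a b, t0 ≤ a → a ≤ b → b ≤ tf → Ioc a b ∩ σ.γ = ∅ → b ≤ a + θ (σ.σ1 a) →
      osgood (ψ (σ.σ1 a)) (max (v (σ.σ1 a) b (x b)) R) ≤
        osgood (ψ (σ.σ1 a)) (max (v (σ.σ1 a) a (x a)) R) + M (σ.σ1 a) := by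
    intro a b ha hab hbf hempty hbθ
    refine hsol.mode_osgood_max_le (hV _) (hψ _) (hp _) (hp0 _) (hDini _) ht0 ha hab
      ((EReal.coe_le_coe_iff.2 hbf).trans_lt htfT) hempty hR ?_ hbθ (hM _ a (ht0.trans ha))
    filter_upwards [huflow] with s hs hsab using hs ⟨ha.trans_lt hsab.1, hsab.2.le.trans hbf⟩
  rw [← hsol.init]
  refine impulsive_iterate_bound (Y := fun s => v (σ.σ1 s) s (x s)) σ.impulse hE hElt hH hHle
    hR.le hΘ0 (fun t ht => hv _ _ _ (ht0.trans ht)) ?_ ?_ ?_ htf le_rfl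
  · exact fun a t ha hat hempty => (hnext a t ha hat hempty).trans (by linarith [hΘ (σ.σ1 a)])
  · intro a t ha hat htf hempty htγ
    have ha0 := ht0.trans ha
    obtain ⟨L, hL, hxt⟩ := hsol.jump t htγ (ha.trans_lt hat)
      ((EReal.coe_le_coe_iff.2 htf).trans_lt htfT)
    have hlim := (hV (σ.σ1 a)).tendsto_left (ha0.trans_lt hat) hL
    have hpos : 0 < max (v (σ.σ1 a) t L) R := hR.trans_le (le_max_right _ _)
    have hflow : osgood (ψ (σ.σ1 a)) (max (v (σ.σ1 a) t L) R) ≤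
        osgood (ψ (σ.σ1 a)) (max (v (σ.σ1 a) a (x a)) R) + M (σ.σ1 a) := by
      have hcont : ContinuousAt (osgood (ψ (σ.σ1 a))) (max (v (σ.σ1 a) t L) R) :=
        ((hψ _).hasDerivAt_osgood hpos).continuousAt
      refine le_of_tendsto (hcont.tendsto.comp (hlim.max tendsto_const_nhds)) ?_
      filter_upwards [Ioo_mem_nhdsLT hat] with b hb
      refine hgrow a b ha hb.1.le (hb.2.le.trans htf) ?_
        (hb.2.le.trans (hnext a t ha hat hempty))
      exact subset_empty_iff.1 (hempty ▸ inter_subset_inter_left _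
        (Ioc_subset_Ioo_right hb.2))
    have hy : v (σ.σ1 t) t (x t) ≤ α (v (σ.σ1 a) t L) ∨ v (σ.σ1 t) t (x t) ≤ π ‖u t‖ := by
      rw [hxt]
      exact hjump (σ.σ1 a) (σ.σ1 t) (σ.σ2 t) t L (u t) (ha0.trans hat.le)
    refine (osgood_jump_le (hψ _) hα (hN _) (hEE _) (hEEψ _) hR (hv _ _ _ (ha0.trans hat.le))
      hflow hy (hujump t htγ ⟨ha.trans_lt hat, htf⟩)).trans ?_
    exact max_le_max (hEEle _ _) le_rfl
  · intro a t ha hat htf hempty htγ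
    have hempty' : Ioc a t ∩ σ.γ = ∅ := by
      refine eq_empty_of_forall_notMem fun r hr => ?_
      rcases hr.1.2.eq_or_lt with rfl | h
      · exact htγ hr.2
      · exact eq_empty_iff_forall_notMem.1 hempty r ⟨⟨hr.1.1, h⟩, hr.2⟩
    have hmode : σ.σ1 t = σ.σ1 a := by
      obtain ⟨τ, hτ, htτ, -, hτempty⟩ := σ.exists_next hRDT ((ht0.trans ha).trans hat.le)
      refine σ.const1 a τ (ht0.trans ha) (eq_empty_of_forall_notMem fun r hr => ?_) t
        ⟨hat.le, htτ⟩
      rcases le_or_gt r t with h | h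
      · exact eq_empty_iff_forall_notMem.1 hempty' r ⟨⟨hr.1.1, h⟩, hr.2⟩
      · exact eq_empty_iff_forall_notMem.1 hτempty r ⟨⟨h, hr.1.2⟩, hr.2⟩
    have hpos : 0 < max (v (σ.σ1 a) a (x a)) R := hR.trans_le (le_max_right _ _)
    have h1 := hgrow a t ha hat.le htf hempty' (hnext a t ha hat hempty)
    rw [← hHHψ _ _ hpos, (hψ _).strictMonoOn_osgood.le_iff_le
      (hR.trans_le (le_max_right _ _)) ((hHH _).pos hpos)] at h1
    simp only [hmode]
    exact (le_max_left _ _).trans (h1.trans (hHHle _ _))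

/-- Theorem 6(b): strong `(h⁰,h)`-ISS of the switched impulsive family under
per-mode maximum dwell times. -/
theorem stmt13 {n m : ℕ} {Ic Id : Type*} [Finite Ic]
    (F : Ic → ℝ → Stt n → Stt m → Stt n) (G : Id → ℝ → Stt n → Stt m → Stt n)
    (h0 h : ℝ → Stt n → ℝ)
    (hh0 : ∀ (t : ℝ) (ξ : Stt n), 0 ≤ t → 0 ≤ h0 t ξ)
    (hh : ∀ (t : ℝ) (ξ : Stt n), 0 ≤ t → 0 ≤ h t ξ)
    (SW : Set (SwSignal Ic Id))
    (v : Ic → ℝ → Stt n → ℝ) (φ1 φ2 χ π : ℝ → ℝ)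
    (p : Ic → ℝ → ℝ) (φb : Ic → ℝ → ℝ) (αb : ℝ → ℝ)
    (hp : ∀ i : Ic, LocIntegrable (p i)) (hpnn : ∀ (i : Ic) (t : ℝ), 0 ≤ t → 0 ≤ p i t)
    (hφbc : ∀ i : Ic, ContinuousOn (φb i) (Set.Ici 0)) (hαb : PosDef αb)
    (hA2 : Assumption2 F G h0 h Set.univ v φ1 φ2 χ π
      (fun i t r => p i t * φb i r) (fun _ _ r => αb r))
    (hnd : ∀ i : Ic, PosDef fun r => -(φb i r))
    (θ : Ic → ℝ) (hθ : ∀ i : Ic, 0 < θ i)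
    (hRDT : ∀ σ ∈ SW, ∀ (i : Ic) (s : ℝ), (s = 0 ∨ s ∈ σ.γ) → σ.σ1 s = i →
      ∃ t ∈ σ.γ, s < t ∧ t ≤ s + θ i)
    (hdiv : ∀ i : Ic,
      ¬ MeasureTheory.IntegrableOn (fun s => (-(φb i s))⁻¹) (Set.Ici 1))
    (hbddP : ∀ i : Ic,
      BddAbove ((fun t => ∫ s in t..(t + θ i), p i s) '' Set.Ici 0))
    (hgt : ∀ i : Ic,
      sSup ((fun t => ∫ s in t..(t + θ i), p i s) '' Set.Ici 0) <
        sInf ((fun a => ∫ s in (αb a)..a, (-(φb i s))⁻¹) '' Set.Ioi 0)) :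
    SwStronglyISS F G SW h0 h := by
  obtain ⟨hφ1, hφ2, hχ, hπ, hV, -, -, hsand, hDini, hj1, hj2⟩ := hA2
  rcases isEmpty_or_nonempty Ic with hIc | hIc
  · refine ⟨_, _, classKL_iterate (E := fun r => r / 2) ClassKInf.id ClassKInf.id ?_
      (fun r hr => half_lt_self hr) one_pos, ClassKInf.id, fun σ => hIc.elim (σ.σ1 0)⟩
    exact ⟨by fun_prop, fun r _ s _ hrs => by simpa using by linarith, by simp,
      fun M => ⟨2 * |M|, by positivity, by linarith [le_abs_self M]⟩⟩
  set ψ : Ic → ℝ → ℝ := fun i r => -(φb i r)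
  set M : Ic → ℝ := fun i => sSup ((fun t => ∫ s in t..(t + θ i), p i s) '' Ici 0)
  set N : Ic → ℝ := fun i => sInf ((fun a => ∫ s in (αb a)..a, (ψ i s)⁻¹) '' Ioi 0)
  have hM : ∀ i t, 0 ≤ t → ∫ s in t..(t + θ i), p i s ≤ M i := fun i t ht =>
    le_csSup (hbddP i) ⟨t, ht, rfl⟩
  have hM0 : ∀ i, 0 ≤ M i := fun i => le_trans
    (intervalIntegral.integral_nonneg (by linarith [hθ i]) fun s hs => hpnn i s hs.1)
    (hM i 0 le_rfl)
  have hMN : ∀ i, M i < N i := hgt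
  have hN : ∀ i a, 0 < a → osgood (ψ i) (αb a) + N i ≤ osgood (ψ i) a := fun i a ha =>
    (hnd i).osgood_jump_of_sInf hαb ((hM0 i).trans_lt (hMN i)) ha
  have hsurj : ∀ i y, ∃ r, 0 < r ∧ osgood (ψ i) r = y := fun i =>
    (hnd i).osgood_surjective ((hnd i).osgood_unbounded_above (hdiv i))
      (PosDef.osgood_unbounded_below hαb ((hM0 i).trans_lt (hMN i)) (hN i))
  choose HH hHH hHHψ using fun i => (hnd i).exists_osgood_shift (hsurj i) (M i)
  choose EE hEE hEEψ using fun i => (hnd i).exists_osgood_shift (hsurj i) (M i - N i)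
  obtain ⟨H, hH, hHHle, -⟩ := ClassKInf.exists_max hHH
  obtain ⟨E, hE, hEEle, hEex⟩ := ClassKInf.exists_max hEE
  have hElt : ∀ r, 0 < r → E r < r := fun r hr => by
    obtain ⟨i, hi⟩ := hEex r
    rw [hi, ← (hnd i).strictMonoOn_osgood.lt_iff_lt ((hEE i).pos hr) hr]
    linarith [hEEψ i r hr, hMN i]
  have hHle : ∀ r, 0 ≤ r → r ≤ H r := fun r hr => by
    obtain ⟨i⟩ := hIc
    rcases hr.eq_or_lt with rfl | hr
    · exact hH.2.2.1.ge
    · refine le_trans ?_ (hHHle i r)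
      rw [← (hnd i).strictMonoOn_osgood.le_iff_le hr ((hHH i).pos hr)]
      linarith [hHHψ i r hr, hM0 i]
  obtain ⟨Θ, hΘ⟩ : ∃ Θ, ∀ i, θ i ≤ Θ := by
    obtain ⟨i, hi⟩ := Finite.exists_max θ
    exact ⟨_, hi⟩
  have hΘ0 : 0 < Θ := (hθ hIc.some).trans_le (hΘ _)
  obtain ⟨κ, hκ, hκφ⟩ := hφ1.exists_inverse
  obtain ⟨R, hR, hRle, -⟩ := ClassKInf.exists_max (E := fun b : Bool => if b then χ else π)
    (by rintro (_ | _) <;> simpa)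
  have hχR : ∀ r, χ r ≤ R r := fun r => by simpa using hRle true r
  have hπR : ∀ r, π r ≤ R r := fun r => by simpa using hRle false r
  refine ⟨_, _, classKL_iterate (hκ.comp hH) hφ2 hE hElt hΘ0, (hκ.comp hH).comp hR, ?_⟩
  intro σ hσ t0 x0 u T x ht0 hu hmax t ht htT
  have hsol := hmax.1
  have hv : ∀ i s ξ, 0 ≤ s → 0 ≤ v i s ξ := fun i s ξ hs =>
    (hφ1.nonneg (hh s ξ hs)).trans (hsand i s ξ hs).1
  set U := inputNorm σ.γ u (Ioc t0 t) with hU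
  set k := nJumps σ.γ t0 t with hk
  have hU0 : 0 ≤ U := inputNorm_nonneg _
  have hv0 : 0 ≤ v (σ.σ1 t0) t0 x0 := hv _ _ _ ht0
  have hbound : ∀ ε, 0 < ε → t - t0 ≤ (k + 1) * Θ ∧
      v (σ.σ1 t) t (x t) ≤ H (max (E^[k] (v (σ.σ1 t0) t0 x0)) (R U + ε)) := by
    intro ε hε
    refine hsol.switched_bound hV hv hnd hp hpnn hαb ?_ ?_ (hRDT σ hσ) hΘ hΘ0.le hM hN hE hElt
      hEE hEEψ hEEle hH hHle hHH hHHψ hHHle ht0 ht htT (add_pos_of_nonneg_of_pos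
        (hR.nonneg hU0) hε) ?_ ?_ (χ := χ) (π := π)
    · intro i s ξ μ hs hμ
      refine (hDini i s ξ μ hs hμ).trans (le_of_eq ?_)
      simp only [mul_neg]
    · intro ι i j s ξ μ hs
      rcases le_total (χ ‖μ‖) (v ι s ξ) with hle | hle
      · exact Or.inl (hj1 ι i j (mem_univ _) s ξ μ hs hle)
      · exact Or.inr (hj2 ι i j (mem_univ _) s ξ μ hs hle)
    · filter_upwards [hu.ae_norm_le_inputNorm (γ := σ.γ) (b := t) ht0] with s hs hst
      linarith [hχ.le (norm_nonneg _) (hs hst), hχR U]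
    · intro s hs hst
      linarith [hπ.le (norm_nonneg _) (σ.impulse.norm_le_inputNorm (u := u) hs hst), hπR U]
  have hvt : v (σ.σ1 t) t (x t) ≤ H (max (E^[k] (v (σ.σ1 t0) t0 x0)) (R U)) :=
    hH.le_of_forall_pos_add ((hE.iterate k).nonneg hv0) fun ε hε => (hbound ε hε).2
  have htime := (hbound 1 one_pos).1
  have hφ20 : 0 ≤ φ2 (h0 t0 x0) := hφ2.nonneg (hh0 _ _ ht0)
  have hfloor : ⌊(t - t0 + (k : ℝ) - Θ) / (Θ + 1)⌋₊ ≤ k := by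
    refine Nat.floor_le_of_le ?_
    rw [div_le_iff₀ (by positivity)]
    linarith
  set q := ⌊(t - t0 + (k : ℝ) - Θ) / (Θ + 1)⌋₊
  have hiter : E^[k] (v (σ.σ1 t0) t0 x0) ≤ E^[q] (φ2 (h0 t0 x0)) :=
    ((hE.iterate k).le hv0 (hsand _ _ _ ht0).2).trans
      (antitone_iterate_of_lt_self hE hElt hφ20 hfloor)
  have hq0 : 0 ≤ E^[q] (φ2 (h0 t0 x0)) := (hE.iterate q).nonneg hφ20
  have hR0 : 0 ≤ R U := hR.nonneg hU0
  have htnn : 0 ≤ t := ht0.trans ht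
  calc h t (x t) = κ (φ1 (h t (x t))) := (hκφ _ (hh _ _ htnn)).symm
    _ ≤ κ (H (max (E^[q] (φ2 (h0 t0 x0))) (R U))) := by
      refine hκ.le (hφ1.nonneg (hh _ _ htnn)) (((hsand _ _ _ htnn).1.trans hvt).trans ?_)
      exact hH.le (hR0.trans (le_max_right _ _)) (max_le_max hiter le_rfl)
    _ = max (κ (H (E^[q] (φ2 (h0 t0 x0))))) (κ (H (R U))) := (hκ.comp hH).map_max hq0 hR0
    _ ≤ κ (H (E^[q] (φ2 (h0 t0 x0)))) + κ (H (R U)) :=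
      max_le_add_of_nonneg ((hκ.comp hH).nonneg hq0) ((hκ.comp hH).nonneg hR0)

end
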